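/- Let N be a positive integer and r ≥ 1 an integer. Suppose that for each i ∈ {0, 1, …, N−1} the real sequences (a_{jN+i−1}/a_{jN+i} : j ≥ 1), (b_{jN+i}/a_{jN+i} : j ≥ 0) and (1/a_{jN+i} : j ≥ 0) belong to 𝒟_r, and that a_{n−1}/a_n → 1, b_n/a_n → q, a_n → ∞ and ∑_{n=0}^∞ 1/a_n = ∞. If |q| < 2 and q ∉ {2 cos(jπ/N) : j = 1, 2, …, N−1}, then, with μ the unique probability measure on ℝ satisfying ∫ p_n p_m dμ = δ_{nm} for all n, m, the measure μ is absolutely continuous with a density w that is continuous and strictly positive on ℝ, and lim_{n→∞} ( ∑_{j=0}^n 1/a_j )^{−1} · ∑_{j=0}^n p_j(x)² = 1 / (π √(4 − q²) w(x)), locally uniformly with respect to x ∈ ℝ. -/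

import Mathlib

open Filter Topology MeasureTheory Real

noncomputable section

/-- The orthonormal polynomials `p_n` associated to `(a_n)`, `(b_n)`. -/
def opoly (a b : ℕ → ℝ) : ℕ → ℝ → ℝ
  | 0 => fun _ => 1
  | 1 => fun x => (x - b 0) / a 0
  | (n + 2) => fun x =>
      ((x - b (n + 1)) * opoly a b (n + 1) x - a n * opoly a b n x) / a (n + 1)

/-- Iterated forward difference of a sequence. -/
def iterDiff (f : ℕ → ℝ) : ℕ → ℕ → ℝ
  | 0, n => f n
  | (j + 1), n => iterDiff f j (n + 1) - iterDiff f j n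

/-- Membership of a real sequence in the Stolz class `𝒟_r`. -/
def memD (r : ℕ) (f : ℕ → ℝ) : Prop :=
  (∃ C, ∀ n, |f n| ≤ C) ∧
    ∀ m ∈ Finset.Icc 1 r, Summable fun n : ℕ => |iterDiff f m n| ^ ((r : ℝ) / m)


/-- The filter `j → ∞` uniformly in `x ∈ K`. -/
def uf (K : Set ℝ) : Filter (ℕ × ℝ) := atTop ×ˢ 𝓟 K

/-- shift -/
def shf {E : Type*} (f : ℕ × ℝ → E) : ℕ × ℝ → E := fun p => f (p.1 + 1, p.2)

theorem tendsto_shift (K : Set ℝ) :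
    Tendsto (fun p : ℕ × ℝ => (p.1 + 1, p.2)) (uf K) (uf K) :=
  (tendsto_add_atTop_nat 1).prodMap tendsto_id

theorem eventually_uf {K : Set ℝ} {P : ℕ × ℝ → Prop} :
    (∀ᶠ p in uf K, P p) ↔ ∃ J, ∀ j ≥ J, ∀ x ∈ K, P (j, x) := by
  unfold uf
  rw [eventually_prod_principal_iff, eventually_atTop]

/-- weight class -/
def WC {E : Type*} [NormedField E] (K : Set ℝ) (h : ℕ → ℝ) : ℕ → ℕ → (ℕ × ℝ → E) → Prop
  | s, 0, f => f =O[uf K] fun p => h p.1 ^ s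
  | s, (k + 1), f => (f =O[uf K] fun p => h p.1 ^ s) ∧ WC K h (s + 1) k (shf f - f)

/-- admissible majorant -/
structure Adm (r : ℕ) (h : ℕ → ℝ) : Prop where
  nonneg : ∀ j, 0 ≤ h j
  slow : ∀ j, h (j + 1) ≤ 2 * h j
  summ : Summable fun j => h j ^ r
  lim : Tendsto h atTop (𝓝 0)

namespace WC
variable {E : Type*} [NormedField E] {K : Set ℝ} {h : ℕ → ℝ} {r : ℕ}

theorem isBigO {s k : ℕ} {f : ℕ × ℝ → E} (hf : WC K h s k f) :
    f =O[uf K] fun p => h p.1 ^ s := by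
  cases k with
  | zero => exact hf
  | succ k => exact hf.1

theorem diff {s k : ℕ} {f : ℕ × ℝ → E} (hf : WC K h s (k + 1) f) :
    WC K h (s + 1) k (shf f - f) := hf.2

theorem congr {s k : ℕ} {f g : ℕ × ℝ → E} (hfg : f =ᶠ[uf K] g) (hf : WC K h s k f) :
    WC K h s k g := by
  induction k generalizing s f g with
  | zero => exact (Asymptotics.isBigO_congr hfg EventuallyEq.rfl).1 hf
  | succ k ih =>
    refine ⟨(Asymptotics.isBigO_congr hfg EventuallyEq.rfl).1 hf.1, ih ?_ hf.2⟩
    have h2 : shf f =ᶠ[uf K] shf g := (tendsto_shift K).eventually hfg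
    exact h2.sub hfg

theorem pred {s k : ℕ} {f : ℕ × ℝ → E} (hf : WC K h s (k + 1) f) : WC K h s k f := by
  induction k generalizing s f with
  | zero => exact hf.1
  | succ k ih => exact ⟨hf.1, ih hf.2⟩

theorem mono {s k k' : ℕ} {f : ℕ × ℝ → E} (hf : WC K h s k f) (hk : k' ≤ k) :
    WC K h s k' f := by
  induction hk with
  | refl => exact hf
  | step _ ih => exact ih hf.pred

theorem h_lim (hh : Adm r h) : Tendsto (fun p : ℕ × ℝ => h p.1) (uf K) (𝓝 0) :=
  hh.lim.comp tendsto_fst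

theorem h_isBigO (hh : Adm r h) {s t : ℕ} (hst : s ≤ t) :
    (fun p : ℕ × ℝ => h p.1 ^ t) =O[uf K] fun p => h p.1 ^ s := by
  obtain ⟨d, rfl⟩ := Nat.exists_eq_add_of_le hst
  have h1 : (fun p : ℕ × ℝ => h p.1 ^ d) =O[uf K] fun _ => (1 : ℝ) :=
    ((h_lim hh).pow d).isBigO_one ℝ
  have := (Asymptotics.isBigO_refl (fun p : ℕ × ℝ => h p.1 ^ s) (uf K)).mul h1
  simpa [pow_add] using this

theorem weight {s s' k : ℕ} {f : ℕ × ℝ → E} (hh : Adm r h) (hf : WC K h s k f) (hs : s' ≤ s) :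
    WC K h s' k f := by
  induction k generalizing s s' f with
  | zero => exact hf.isBigO.trans (h_isBigO hh hs)
  | succ k ih => exact ⟨hf.1.trans (h_isBigO hh hs), ih hf.2 (by omega)⟩

theorem add {s k : ℕ} {f g : ℕ × ℝ → E} (hf : WC K h s k f) (hg : WC K h s k g) :
    WC K h s k (f + g) := by
  induction k generalizing s f g with
  | zero => exact Asymptotics.IsBigO.add hf hg
  | succ k ih =>
    refine ⟨hf.1.add hg.1, ?_⟩
    have : shf (f + g) - (f + g) = (shf f - f) + (shf g - g) := by
      ext p; simp [shf]; ring
    rw [this]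
    exact ih hf.2 hg.2

theorem neg {s k : ℕ} {f : ℕ × ℝ → E} (hf : WC K h s k f) :
    WC K h s k (-f) := by
  induction k generalizing s f with
  | zero => exact Asymptotics.IsBigO.neg_left hf
  | succ k ih =>
    refine ⟨hf.1.neg_left, ?_⟩
    have : shf (-f) - (-f) = -(shf f - f) := by
      ext p; simp [shf]; ring
    rw [this]
    exact ih hf.2

theorem sub {s k : ℕ} {f g : ℕ × ℝ → E} (hf : WC K h s k f) (hg : WC K h s k g) :
    WC K h s k (f - g) := by
  rw [sub_eq_add_neg]; exact hf.add hg.neg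

theorem zero' (s k : ℕ) : WC K h s k (0 : ℕ × ℝ → E) := by
  induction k generalizing s with
  | zero => exact Asymptotics.isBigO_zero _ _
  | succ k ih =>
    refine ⟨Asymptotics.isBigO_zero _ _, ?_⟩
    have : shf (0 : ℕ × ℝ → E) - 0 = 0 := by ext p; simp [shf]
    rw [this]; exact ih _

theorem of_const_j (k : ℕ) (φ : ℝ → E) (hb : ∃ C, ∀ x ∈ K, ‖φ x‖ ≤ C) :
    WC K h 0 k (fun p => φ p.2) := by
  have h0 : (fun p : ℕ × ℝ => φ p.2) =O[uf K] fun p => h p.1 ^ 0 := by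
    obtain ⟨C, hC⟩ := hb
    refine Asymptotics.IsBigO.of_bound C ?_
    rw [eventually_uf]
    exact ⟨0, fun j _ x hx => by simpa using hC x hx⟩
  cases k with
  | zero => exact h0
  | succ k =>
    refine ⟨h0, ?_⟩
    have : (shf (fun p : ℕ × ℝ => φ p.2) - fun p => φ p.2) = 0 := by ext p; simp [shf]
    rw [this]; exact zero' _ _

theorem const (k : ℕ) (c : E) : WC K h 0 k (fun _ => c) :=
  of_const_j k (fun _ => c) ⟨‖c‖, fun _ _ => le_rfl⟩

theorem shift {s k : ℕ} {f : ℕ × ℝ → E} (hh : Adm r h) (hf : WC K h s k f) :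
    WC K h s k (shf f) := by
  have key : ∀ {s : ℕ} {f : ℕ × ℝ → E}, (f =O[uf K] fun p => h p.1 ^ s) →
      (shf f =O[uf K] fun p => h p.1 ^ s) := by
    intro s f hf
    have h1 := hf.comp_tendsto (tendsto_shift K)
    refine h1.trans (Asymptotics.IsBigO.of_bound (2 ^ s) (Eventually.of_forall fun p => ?_))
    simp only [Function.comp]
    rw [norm_pow, norm_pow, ← mul_pow, Real.norm_of_nonneg (hh.nonneg _),
      Real.norm_of_nonneg (hh.nonneg _)]
    exact pow_le_pow_left₀ (hh.nonneg _) (hh.slow _) _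
  induction k generalizing s f with
  | zero => exact key hf
  | succ k ih => exact ⟨key hf.1, ih hf.2⟩

theorem mul {s t k : ℕ} {f g : ℕ × ℝ → E} (hh : Adm r h) (hf : WC K h s k f)
    (hg : WC K h t k g) : WC K h (s + t) k (f * g) := by
  have key : ∀ {s t : ℕ} {f g : ℕ × ℝ → E}, (f =O[uf K] fun p => h p.1 ^ s) →
      (g =O[uf K] fun p => h p.1 ^ t) → ((f * g) =O[uf K] fun p => h p.1 ^ (s + t)) := by
    intro s t f g hf hg
    simp only [pow_add]
    exact hf.mul hg
  induction k generalizing s t f g with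
  | zero => exact key hf hg
  | succ k ih =>
    refine ⟨key hf.1 hg.1, ?_⟩
    have : shf (f * g) - (f * g) = (shf f - f) * shf g + f * (shf g - g) := by
      ext p; simp [shf]; ring
    rw [this]
    refine add ?_ ?_
    · have := ih hf.2 (hg.shift hh).pred
      rwa [show s + t + 1 = s + 1 + t by ring]
    · have := ih hf.pred hg.2
      rwa [show s + t + 1 = s + (t + 1) by ring]

theorem mul0 {k : ℕ} {f g : ℕ × ℝ → E} (hh : Adm r h) (hf : WC K h 0 k f)
    (hg : WC K h 0 k g) : WC K h 0 k (f * g) := hf.mul hh hg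

theorem inv {k : ℕ} {f : ℕ × ℝ → E} (hh : Adm r h) (hf : WC K h 0 k f) {c : E}
    (hc : c ≠ 0) (hl : Tendsto f (uf K) (𝓝 c)) : WC K h 0 k (f⁻¹) := by
  have hO : (f⁻¹) =O[uf K] fun p => h p.1 ^ 0 := by
    simpa using (hl.inv₀ hc).isBigO_one ℝ
  induction k with
  | zero => exact hO
  | succ k ih =>
    refine ⟨hO, ?_⟩
    have hi := ih hf.pred
    have h1 := (((hf.2).mul hh hi).mul hh (hi.shift hh)).neg
    refine congr ?_ h1
    have hne : ∀ᶠ p in uf K, f p ≠ 0 := hl.eventually_ne hc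
    filter_upwards [hne, (tendsto_shift K).eventually hne] with p h1 h2
    simp only [shf, Pi.neg_apply, Pi.mul_apply, Pi.sub_apply, Pi.inv_apply]
    field_simp
    ring

theorem ofReal {s k : ℕ} {f : ℕ × ℝ → ℝ} (hf : WC K h s k f) :
    WC K h s k (fun p => (f p : ℂ)) := by
  have key : ∀ {s : ℕ} {f : ℕ × ℝ → ℝ}, (f =O[uf K] fun p => h p.1 ^ s) →
      ((fun p => (f p : ℂ)) =O[uf K] fun p => h p.1 ^ s) := by
    intro s f hf
    refine Asymptotics.IsBigO.trans (Asymptotics.IsBigO.of_bound 1 ?_) hf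
    simp
  induction k generalizing s f with
  | zero => exact key hf
  | succ k ih =>
    refine ⟨key hf.1, ?_⟩
    have := ih hf.2
    convert this using 1
    ext p; simp [shf]

theorem sqrt {k : ℕ} {f : ℕ × ℝ → ℝ} (hh : Adm r h) (hf : WC K h 0 k f) {c : ℝ}
    (hc : 0 < c) (hl : Tendsto f (uf K) (𝓝 c)) : WC K h 0 k (fun p => Real.sqrt (f p)) := by
  have hsl : Tendsto (fun p => Real.sqrt (f p)) (uf K) (𝓝 (Real.sqrt c)) := hl.sqrt
  have hO : (fun p => Real.sqrt (f p)) =O[uf K] fun p => h p.1 ^ 0 := by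
    simpa using hsl.isBigO_one ℝ
  induction k with
  | zero => exact hO
  | succ k ih =>
    refine ⟨hO, ?_⟩
    have hi := ih hf.pred
    have hs0 : 0 < Real.sqrt c := Real.sqrt_pos.2 hc
    have hsum := hi.add (hi.shift hh)
    have hsumL : Tendsto ((fun p => Real.sqrt (f p)) + shf (fun p => Real.sqrt (f p))) (uf K)
        (𝓝 (Real.sqrt c + Real.sqrt c)) := hsl.add (hsl.comp (tendsto_shift K))
    have h1 := (hf.2).mul hh (hsum.inv hh (by positivity) hsumL)
    refine congr ?_ h1
    have hne : ∀ᶠ p in uf K, 0 < f p := hl.eventually_const_lt hc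
    filter_upwards [hne, (tendsto_shift K).eventually hne] with p h1 h2
    simp only [shf, Pi.mul_apply, Pi.sub_apply, Pi.inv_apply, Pi.add_apply]
    have e1 := Real.sq_sqrt h1.le
    have e2 := Real.sq_sqrt h2.le
    have p1 := Real.sqrt_pos.2 h1
    have p2 := Real.sqrt_pos.2 h2
    rw [← div_eq_mul_inv, div_eq_iff (by positivity)]
    nlinarith

theorem tendsto_zero {s k : ℕ} {f : ℕ × ℝ → E} (hh : Adm r h) (hf : WC K h (s + 1) k f) :
    Tendsto f (uf K) (𝓝 0) := by
  refine hf.isBigO.trans_tendsto ?_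
  have := (h_lim (K := K) hh).pow (s + 1)
  simpa using this

end WC

/-- From the Stolz class to the weight class: one majorant for finitely many sequences. -/
theorem exists_adm {r : ℕ} (hr : 1 ≤ r) {ι : Type*} (I : Finset ι) (f : ι → ℕ → ℝ)
    (hf : ∀ i ∈ I, memD r (f i)) :
    ∃ h, Adm r h ∧ ∀ K : Set ℝ, ∀ i ∈ I, WC K h 0 r (fun p => f i p.1) := by
  have hr0 : (0 : ℝ) < r := by exact_mod_cast hr
  set g : ℕ → ℝ := fun j => ∑ i ∈ I, ∑ m ∈ Finset.Icc 1 r, |iterDiff (f i) m j| ^ ((r : ℝ) / m)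
    with hg
  have hg0 : ∀ j, 0 ≤ g j := fun j => Finset.sum_nonneg fun i _ => Finset.sum_nonneg fun m _ =>
    Real.rpow_nonneg (abs_nonneg _) _
  have hgs : Summable g := by
    refine summable_sum fun i hi => summable_sum fun m hm => (hf i hi).2 m hm
  -- slow majorant
  have hshift : ∀ l, Summable fun j => g (j + l) := fun l => (summable_nat_add_iff l).2 hgs
  clear_value g
  have hprod : Summable fun q : ℕ × ℕ => (1 / 2 : ℝ) ^ q.1 * g (q.2 + q.1) := by
    have hnn : 0 ≤ fun q : ℕ × ℕ => (1 / 2 : ℝ) ^ q.1 * g (q.2 + q.1) :=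
      fun q => mul_nonneg (pow_nonneg (by norm_num) _) (hg0 _)
    rw [summable_prod_of_nonneg hnn]
    have hrow : ∀ l : ℕ, Summable fun j => (1 / 2 : ℝ) ^ l * g (j + l) :=
      fun l => (hshift l).mul_left ((1 / 2 : ℝ) ^ l)
    have hgeo : Summable fun l : ℕ => (1 / 2 : ℝ) ^ l * ∑' j, g j :=
      summable_geometric_two.mul_right _
    refine ⟨hrow, ?_⟩
    refine Summable.of_nonneg_of_le (fun l => tsum_nonneg fun j => hnn (l, j)) ?_ hgeo
    intro l
    show ∑' j, (1 / 2 : ℝ) ^ l * g (j + l) ≤ _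
    rw [tsum_mul_left]
    refine mul_le_mul_of_nonneg_left ?_ (by positivity)
    have := hgs.sum_add_tsum_nat_add l
    have h2 : 0 ≤ ∑ i ∈ Finset.range l, g i := Finset.sum_nonneg fun i _ => hg0 i
    linarith
  have hcol : ∀ j, Summable fun l => (1 / 2 : ℝ) ^ l * g (j + l) := fun j =>
    hprod.prod_symm.prod_factor j
  set G : ℕ → ℝ := fun j => ∑' l, (1 / 2 : ℝ) ^ l * g (j + l) with hG
  have hGs : Summable G := hprod.prod_symm.prod
  have hG0 : ∀ j, 0 ≤ G j := fun j => tsum_nonneg fun l => mul_nonneg (by positivity) (hg0 _)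
  have hsplit : ∀ j, G j = g j + (1 / 2) * G (j + 1) := by
    intro j
    simp only [hG]
    rw [(hcol j).tsum_eq_zero_add, ← tsum_mul_left]
    simp only [pow_zero, one_mul, add_zero]
    congr 1
    refine tsum_congr fun l => ?_
    rw [show j + (l + 1) = j + 1 + l by ring]; ring
  have hgG : ∀ j, g j ≤ G j := fun j => by have := hsplit j; have := hG0 (j + 1); linarith
  have hGslow : ∀ j, G (j + 1) ≤ 2 * G j := fun j => by
    have := hsplit j; have := hg0 j; linarith
  refine ⟨fun j => G j ^ ((1 : ℝ) / r), ⟨fun j => Real.rpow_nonneg (hG0 j) _, ?_, ?_, ?_⟩, ?_⟩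
  · intro j
    calc G (j + 1) ^ ((1 : ℝ) / r) ≤ (2 * G j) ^ ((1 : ℝ) / r) :=
          Real.rpow_le_rpow (hG0 _) (hGslow j) (by positivity)
      _ = 2 ^ ((1 : ℝ) / r) * G j ^ ((1 : ℝ) / r) := Real.mul_rpow (by norm_num) (hG0 j)
      _ ≤ 2 * G j ^ ((1 : ℝ) / r) := by
          gcongr
          · exact Real.rpow_nonneg (hG0 j) _
          · conv_rhs => rw [← Real.rpow_one 2]
            apply Real.rpow_le_rpow_of_exponent_le (by norm_num)
            rw [div_le_one hr0]; exact_mod_cast hr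
  · refine hGs.congr fun j => ?_
    rw [← Real.rpow_natCast, ← Real.rpow_mul (hG0 j)]
    field_simp; simp
  · have := hGs.tendsto_atTop_zero.rpow_const (p := (1 : ℝ) / r) (Or.inr (by positivity))
    rwa [Real.zero_rpow (by positivity)] at this
  · intro K i hi
    obtain ⟨⟨C, hC⟩, hD⟩ := hf i hi
    have key : ∀ m ∈ Finset.Icc 1 r, ∀ j, |iterDiff (f i) m j| ≤ (G j ^ ((1 : ℝ) / r)) ^ m := by
      intro m hm j
      have hm1 : 1 ≤ m := (Finset.mem_Icc.1 hm).1
      have hm0 : (0 : ℝ) < m := by exact_mod_cast hm1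
      have h1 : |iterDiff (f i) m j| ^ ((r : ℝ) / m) ≤ G j := by
        refine le_trans ?_ (hgG j)
        rw [hg]
        have h2 : |iterDiff (f i) m j| ^ ((r : ℝ) / m) ≤
            ∑ m ∈ Finset.Icc 1 r, |iterDiff (f i) m j| ^ ((r : ℝ) / m) :=
          Finset.single_le_sum (f := fun m : ℕ => |iterDiff (f i) m j| ^ ((r : ℝ) / m))
            (fun m _ => Real.rpow_nonneg (abs_nonneg _) _) hm
        refine h2.trans ?_
        exact Finset.single_le_sum
          (f := fun i => ∑ m ∈ Finset.Icc 1 r, |iterDiff (f i) m j| ^ ((r : ℝ) / m))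
          (fun i _ => Finset.sum_nonneg fun m _ => Real.rpow_nonneg (abs_nonneg _) _) hi
      have h3 := Real.rpow_le_rpow (Real.rpow_nonneg (abs_nonneg _) _) h1
        (show (0 : ℝ) ≤ (m : ℝ) / r by positivity)
      rw [← Real.rpow_mul (abs_nonneg _)] at h3
      rw [show (r : ℝ) / m * (m / r) = 1 by field_simp, Real.rpow_one] at h3
      rw [← Real.rpow_natCast, ← Real.rpow_mul (hG0 j)]
      convert h3 using 2
      ring
    have gen : ∀ k m : ℕ, m + k = r →
        WC K (fun j => G j ^ ((1 : ℝ) / r)) m k (fun p => iterDiff (f i) m p.1) := by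
      have hO : ∀ m, m ≤ r → (fun p : ℕ × ℝ => iterDiff (f i) m p.1) =O[uf K]
          fun p => (G p.1 ^ ((1 : ℝ) / r)) ^ m := by
        intro m hm
        rcases Nat.eq_zero_or_pos m with rfl | hm0
        · refine Asymptotics.IsBigO.of_bound C (Eventually.of_forall fun p => ?_)
          simpa [iterDiff] using hC p.1
        · refine Asymptotics.IsBigO.of_bound 1 (Eventually.of_forall fun p => ?_)
          rw [one_mul, Real.norm_eq_abs, Real.norm_eq_abs]
          exact (key m (Finset.mem_Icc.2 ⟨hm0, hm⟩) p.1).trans (le_abs_self _)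
      intro k
      induction k with
      | zero => intro m hm; exact hO m (by omega)
      | succ k ih =>
        intro m hm
        refine ⟨hO m (by omega), ?_⟩
        exact ih (m + 1) (by omega)
    exact gen r 0 (by omega)


/-- Residual of the Riccati equation. -/
def resid (A B C D m : ℕ × ℝ → ℂ) : ℕ × ℝ → ℂ := fun p =>
  (C p + D p * m p) / (A p + B p * m p) - shf m p

theorem newton_step {r : ℕ} {h : ℕ → ℝ} (hh : Adm r h) {K : Set ℝ} {A B C D m : ℕ × ℝ → ℂ}
    {A0 B0 C0 D0 t lam : ℂ}
    (hA : Tendsto A (uf K) (𝓝 A0)) (hB : Tendsto B (uf K) (𝓝 B0))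
    (hC : Tendsto C (uf K) (𝓝 C0)) (hD : Tendsto D (uf K) (𝓝 D0))
    (hm : Tendsto m (uf K) (𝓝 t))
    (hlam : A0 + B0 * t = lam) (hdet : A0 * D0 - B0 * C0 = 1) (hl0 : lam ≠ 0) (hl1 : lam ^ 2 ≠ 1)
    {k d : ℕ}
    (wA : WC K h 0 (d + 2) A) (wB : WC K h 0 (d + 2) B)
    (wC : WC K h 0 (d + 2) C) (wD : WC K h 0 (d + 2) D) (wm : WC K h 0 (d + 2) m)
    (we : WC K h (k + 1) (d + 1) (resid A B C D m)) :
    ∃ m' : ℕ × ℝ → ℂ, Tendsto m' (uf K) (𝓝 t) ∧ WC K h 0 (d + 1) m' ∧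
      WC K h (k + 2) d (resid A B C D m') := by
  set e := resid A B C D m with he
  have wA := wA.pred
  have wB := wB.pred
  have wC := wC.pred
  have wD := wD.pred
  have wm1 := wm.pred
  set P : ℕ × ℝ → ℂ := A + B * m with hP
  have wP : WC K h 0 (d + 1) P := wA.add (wB.mul0 hh wm1)
  have lP : Tendsto P (uf K) (𝓝 lam) := by rw [← hlam]; exact hA.add (hB.mul hm)
  set dt : ℕ × ℝ → ℂ := A * D - B * C with hdt
  have wdt : WC K h 0 (d + 1) dt := (wA.mul0 hh wD).sub (wB.mul0 hh wC)
  have ldt : Tendsto dt (uf K) (𝓝 1) := by rw [← hdet]; exact (hA.mul hD).sub (hB.mul hC)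
  have wPi : WC K h 0 (d + 1) (P⁻¹) := wP.inv hh hl0 lP
  have lPi : Tendsto P⁻¹ (uf K) (𝓝 lam⁻¹) := lP.inv₀ hl0
  set R : ℕ × ℝ → ℂ := (fun _ => 1) - dt * P⁻¹ * P⁻¹ with hR
  have wR : WC K h 0 (d + 1) R := (WC.const _ _).sub ((wdt.mul0 hh wPi).mul0 hh wPi)
  have lR : Tendsto R (uf K) (𝓝 (1 - 1 * lam⁻¹ * lam⁻¹)) :=
    tendsto_const_nhds.sub ((ldt.mul lPi).mul lPi)
  have hR0 : (1 - 1 * lam⁻¹ * lam⁻¹) ≠ 0 := by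
    intro h0
    apply hl1
    have : lam⁻¹ * lam⁻¹ = 1 := by linear_combination -h0
    field_simp at this
    exact this.symm
  set c : ℕ × ℝ → ℂ := e * R⁻¹ with hc
  have wc : WC K h (k + 1) (d + 1) c := by
    have := we.mul hh (wR.inv hh hR0 lR)
    simpa using this
  have lc : Tendsto c (uf K) (𝓝 0) := wc.tendsto_zero hh
  set P' : ℕ × ℝ → ℂ := P + B * c with hP'
  have wc0 : WC K h 0 (d + 1) c := wc.weight hh (by omega)
  have wP' : WC K h 0 (d + 1) P' := wP.add (wB.mul0 hh wc0)
  have lP' : Tendsto P' (uf K) (𝓝 lam) := by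
    have := lP.add (hB.mul lc)
    rw [mul_zero, add_zero] at this
    exact this
  have wP'i : WC K h 0 (d + 1) (P'⁻¹) := wP'.inv hh hl0 lP'
  have lm' : Tendsto (m + c) (uf K) (𝓝 t) := by
    have := hm.add lc
    rw [add_zero] at this
    exact this
  refine ⟨m + c, lm', wm1.add wc0, ?_⟩
  have w1 : WC K h (k + 2) d (shf c - c) := wc.diff
  have w2 : WC K h (k + 2) d (dt * B * P⁻¹ * P⁻¹ * P'⁻¹ * (c * c)) := by
    have h1 := (((wdt.mul0 hh wB).mul0 hh wPi).mul0 hh wPi).mul0 hh wP'i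
    have h2 := h1.mul hh (wc.mul hh wc)
    exact (h2.weight hh (by omega)).pred
  refine WC.congr ?_ (w1.neg.sub w2)
  filter_upwards [lP.eventually_ne hl0, lP'.eventually_ne hl0, lR.eventually_ne hR0]
    with p h1 h2 h3
  have hcR : c p * R p = e p := by
    simp only [hc, Pi.mul_apply, Pi.inv_apply]
    field_simp
  have ep : e p = (C p + D p * m p) / P p - shf m p := rfl
  have Rp : R p = 1 - dt p * (P p)⁻¹ * (P p)⁻¹ := rfl
  have P'p : P' p = P p + B p * c p := rfl
  have Pp : P p = A p + B p * m p := rfl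
  have dtp : dt p = A p * D p - B p * C p := rfl
  have s1 : shf (m + c) p = shf m p + shf c p := rfl
  have key : (C p + D p * (m p + c p)) / (A p + B p * (m p + c p)) =
      (C p + D p * m p) / P p + dt p * c p / (P p * P' p) := by
    have hd : A p + B p * (m p + c p) = P' p := by rw [P'p, Pp]; ring
    rw [hd]
    field_simp
    rw [P'p, Pp, dtp]
    ring
  show - (shf c p - c p) - dt p * B p * (P p)⁻¹ * (P p)⁻¹ * (P' p)⁻¹ * (c p * c p) =
    (C p + D p * (m p + c p)) / (A p + B p * (m p + c p)) - shf (m + c) p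
  rw [key, s1]
  have e2 : (C p + D p * m p) / P p = e p + shf m p := by rw [ep]; ring
  rw [e2, ← hcR, Rp]
  have : dt p * c p / (P p * P' p) = dt p * c p * (P p)⁻¹ * (P p)⁻¹
      - dt p * B p * (P p)⁻¹ * (P p)⁻¹ * (P' p)⁻¹ * (c p * c p) := by
    field_simp
    rw [P'p]; ring
  rw [this]
  ring

theorem newton {r : ℕ} (hr : 1 ≤ r) {h : ℕ → ℝ} (hh : Adm r h) {K : Set ℝ}
    {A B C D : ℕ × ℝ → ℝ} {A0 B0 C0 D0 : ℝ} {t lam : ℂ}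
    (hA : Tendsto A (uf K) (𝓝 A0)) (hB : Tendsto B (uf K) (𝓝 B0))
    (hC : Tendsto C (uf K) (𝓝 C0)) (hD : Tendsto D (uf K) (𝓝 D0))
    (ht : 0 < t.im) (hB0 : B0 ≠ 0)
    (hlam : (A0 : ℂ) + B0 * t = lam) (hlam2 : (C0 : ℂ) + D0 * t = lam * t)
    (hdet : A0 * D0 - B0 * C0 = 1) (hl0 : lam ≠ 0) (hl1 : lam ^ 2 ≠ 1)
    (wA : WC K h 0 r A) (wB : WC K h 0 r B) (wC : WC K h 0 r C) (wD : WC K h 0 r D) :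
    ∃ m : ℕ × ℝ → ℂ, Tendsto m (uf K) (𝓝 t) ∧
      (resid (fun p => (A p : ℂ)) (fun p => (B p : ℂ)) (fun p => (C p : ℂ)) (fun p => (D p : ℂ)) m)
        =O[uf K] fun p => h p.1 ^ r := by
  have e1 : D0 - A0 = 2 * B0 * t.re := by
    have h1 := congrArg Complex.im hlam2
    rw [← hlam] at h1
    simp at h1
    have : t.im * (D0 - A0 - 2 * B0 * t.re) = 0 := by linear_combination h1
    rcases mul_eq_zero.1 this with h | h
    · exact absurd h ht.ne'
    · linarith
  have e2 : C0 = - B0 * (t.re ^ 2 + t.im ^ 2) := by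
    have h1 := congrArg Complex.re hlam2
    rw [← hlam] at h1
    simp at h1
    linear_combination h1 - t.re * e1
  have cA : Tendsto (fun p => (A p : ℂ)) (uf K) (𝓝 (A0 : ℂ)) := (Complex.continuous_ofReal.tendsto _).comp hA
  have cB : Tendsto (fun p => (B p : ℂ)) (uf K) (𝓝 (B0 : ℂ)) := (Complex.continuous_ofReal.tendsto _).comp hB
  have cC : Tendsto (fun p => (C p : ℂ)) (uf K) (𝓝 (C0 : ℂ)) := (Complex.continuous_ofReal.tendsto _).comp hC
  have cD : Tendsto (fun p => (D p : ℂ)) (uf K) (𝓝 (D0 : ℂ)) := (Complex.continuous_ofReal.tendsto _).comp hD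
  have main : ∀ k d : ℕ, k + d + 1 = r → ∃ m : ℕ × ℝ → ℂ, Tendsto m (uf K) (𝓝 t) ∧
      WC K h 0 (d + 1) m ∧ WC K h (k + 1) d (resid (fun p => (A p : ℂ)) (fun p => (B p : ℂ))
        (fun p => (C p : ℂ)) (fun p => (D p : ℂ)) m) := by
    intro k
    induction k with
    | zero =>
      intro d hd
      obtain rfl : r = d + 1 := by omega
      set rho : ℕ × ℝ → ℝ := (D - A) * ((fun _ => 2) * B)⁻¹ with hrho
      have l2B : Tendsto ((fun _ => (2 : ℝ)) * B) (uf K) (𝓝 (2 * B0)) :=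
        tendsto_const_nhds.mul hB
      have w2B : WC K h 0 (d + 1) ((fun _ => (2 : ℝ)) * B) := (WC.const _ _).mul0 hh wB
      have h2B : 2 * B0 ≠ 0 := by simpa using hB0
      have lrho : Tendsto rho (uf K) (𝓝 t.re) := by
        have : t.re = (D0 - A0) * (2 * B0)⁻¹ := by rw [e1]; field_simp
        rw [this]
        exact (hD.sub hA).mul (l2B.inv₀ h2B)
      have wrho : WC K h 0 (d + 1) rho := (wD.sub wA).mul0 hh (w2B.inv hh h2B l2B)
      set kap : ℕ × ℝ → ℝ := -(C * B⁻¹) - rho * rho with hkap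
      have lkap : Tendsto kap (uf K) (𝓝 (t.im ^ 2)) := by
        have : t.im ^ 2 = -(C0 * B0⁻¹) - t.re * t.re := by rw [e2]; field_simp; ring
        rw [this]
        exact ((hC.mul (hB.inv₀ hB0)).neg).sub (lrho.mul lrho)
      have wkap : WC K h 0 (d + 1) kap :=
        ((wC.mul0 hh (wB.inv hh hB0 hB)).neg).sub (wrho.mul0 hh wrho)
      have wsq := wkap.sqrt hh (by positivity) lkap
      have lsq : Tendsto (fun p => Real.sqrt (kap p)) (uf K) (𝓝 t.im) := by
        have := lkap.sqrt
        rwa [Real.sqrt_sq ht.le] at this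
      set m : ℕ × ℝ → ℂ := (fun p => (rho p : ℂ)) + (fun _ => Complex.I) *
        (fun p => (Real.sqrt (kap p) : ℂ)) with hm
      have wm : WC K h 0 (d + 1) m := wrho.ofReal.add ((WC.const _ _).mul0 hh wsq.ofReal)
      have lm : Tendsto m (uf K) (𝓝 t) := by
        have : t = (t.re : ℂ) + Complex.I * (t.im : ℂ) := by
          rw [mul_comm]; exact (Complex.re_add_im t).symm
        rw [this]
        exact ((Complex.continuous_ofReal.tendsto _).comp lrho).add
          (tendsto_const_nhds.mul ((Complex.continuous_ofReal.tendsto _).comp lsq))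
      refine ⟨m, lm, wm, ?_⟩
      have w1 : WC K h 1 d (-(shf m - m)) := wm.diff.neg
      refine WC.congr ?_ w1
      have lP : Tendsto (fun p => (A p : ℂ) + B p * m p) (uf K) (𝓝 lam) := by
        rw [← hlam]; exact cA.add (cB.mul lm)
      filter_upwards [hB.eventually_ne hB0, lP.eventually_ne hl0,
        lkap.eventually_const_lt (show (0 : ℝ) < t.im ^ 2 by positivity)] with p hBp hPp hkp
      simp only [resid, Pi.neg_apply, Pi.sub_apply, neg_sub]
      congr 1
      rw [eq_div_iff hPp]
      have hmp : m p = (rho p : ℂ) + Complex.I * (Real.sqrt (kap p) : ℂ) := rfl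
      have hI : Complex.I ^ 2 = -1 := Complex.I_sq
      have hs : ((Real.sqrt (kap p) : ℝ) : ℂ) ^ 2 = (kap p : ℂ) := by
        rw [← Complex.ofReal_pow, Real.sq_sqrt hkp.le]
      have hk : (B p : ℂ) * kap p = -C p - B p * rho p ^ 2 := by
        have : B p * kap p = -C p - B p * rho p ^ 2 := by
          simp only [hkap, Pi.sub_apply, Pi.neg_apply, Pi.mul_apply, Pi.inv_apply]
          field_simp
        exact_mod_cast this
      have hrr : 2 * (B p : ℂ) * rho p = D p - A p := by
        have : 2 * B p * rho p = D p - A p := by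
          simp only [hrho, Pi.sub_apply, Pi.mul_apply, Pi.inv_apply]
          field_simp
        exact_mod_cast this
      rw [hmp]
      linear_combination (B p * (Real.sqrt (kap p) : ℂ) ^ 2) * hI - B p * hs - hk
        + (rho p + Complex.I * (Real.sqrt (kap p) : ℂ)) * hrr
    | succ k ih =>
      intro d hd
      obtain ⟨m, lm, wm, we⟩ := ih (d + 1) (by omega)
      have hdetc : (A0 : ℂ) * D0 - B0 * C0 = 1 := by exact_mod_cast hdet
      obtain ⟨m', h1, h2, h3⟩ := newton_step hh cA cB cC cD lm hlam hdetc hl0 hl1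
        (wA.ofReal.mono (by omega)) (wB.ofReal.mono (by omega)) (wC.ofReal.mono (by omega))
        (wD.ofReal.mono (by omega)) wm we
      exact ⟨m', h1, h2, h3⟩
  obtain ⟨m, lm, _, we⟩ := main (r - 1) 0 (by omega)
  refine ⟨m, lm, ?_⟩
  have := we.isBigO
  rwa [show r - 1 + 1 = r by omega] at this


theorem tuo_iff {K : Set ℝ} {f : ℕ → ℝ → ℝ} {g : ℝ → ℝ} :
    TendstoUniformlyOn f g atTop K ↔
      Tendsto (fun p : ℕ × ℝ => f p.1 p.2 - g p.2) (uf K) (𝓝 0) := by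
  rw [Metric.tendstoUniformlyOn_iff, Metric.tendsto_nhds]
  refine forall_congr' fun ε => forall_congr' fun _ => ?_
  rw [eventually_uf, eventually_atTop]
  simp [Real.dist_eq, abs_sub_comm]

theorem unif_mul {K : Set ℝ} {f ρ : ℕ × ℝ → ℝ} {g : ℝ → ℝ} {c : ℝ}
    (hf : Tendsto (fun p : ℕ × ℝ => f p - g p.2) (uf K) (𝓝 0))
    (hg : ∃ C, ∀ x ∈ K, |g x| ≤ C) (hρ : Tendsto ρ (uf K) (𝓝 c)) :
    Tendsto (fun p : ℕ × ℝ => f p * ρ p - c * g p.2) (uf K) (𝓝 0) := by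
  have h1 : Tendsto (fun p : ℕ × ℝ => (f p - g p.2) * ρ p) (uf K) (𝓝 0) := by
    simpa using hf.mul hρ
  have h2 : Tendsto (fun p : ℕ × ℝ => (ρ p - c) * g p.2) (uf K) (𝓝 0) := by
    obtain ⟨C, hC⟩ := hg
    have hO : (fun p : ℕ × ℝ => g p.2) =O[uf K] fun _ => (1 : ℝ) := by
      refine Asymptotics.IsBigO.of_bound C ?_
      rw [eventually_uf]
      exact ⟨0, fun j _ x hx => by simpa using hC x hx⟩
    have hz : Tendsto (fun p => ρ p - c) (uf K) (𝓝 0) := by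
      simpa using hρ.sub_const c
    have ho : (fun p => ρ p - c) =o[uf K] fun _ => (1 : ℝ) :=
      (Asymptotics.isLittleO_one_iff ℝ).2 hz
    have := ho.mul_isBigO hO
    rw [← Asymptotics.isLittleO_one_iff ℝ]
    simpa using this
  have := h1.add h2
  rw [add_zero] at this
  refine this.congr fun p => ?_
  ring

theorem exp_bound {e : ℝ} (h0 : 0 ≤ e) (h1 : e ≤ 1 / 2) : Real.exp (-(2 * e)) ≤ 1 - e := by
  rw [Real.exp_neg, inv_le_comm₀ (Real.exp_pos _) (by linarith)]
  have := Real.add_one_le_exp (2 * e)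
  refine le_trans ?_ this
  rw [inv_le_iff_one_le_mul₀ (by linarith)]
  nlinarith

/-- Convergence of slowly varying positive sequences. -/
theorem conv_pos {K : Set ℝ} {L : ℕ → ℝ → ℝ} {ε : ℕ → ℝ} (hε : Summable ε) (hε0 : ∀ j, 0 ≤ ε j)
    (J : ℕ) (hpos : ∀ j ≥ J, ∀ x ∈ K, 0 < L j x)
    (hstep : ∀ j ≥ J, ∀ x ∈ K, |L (j + 1) x - L j x| ≤ ε j * L j x)
    (hbd : ∀ j ≥ J, ∃ C, ∀ x ∈ K, L j x ≤ C) :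
    ∃ l : ℝ → ℝ, Tendsto (fun p : ℕ × ℝ => L p.1 p.2 - l p.2) (uf K) (𝓝 0) ∧
      (∀ x ∈ K, 0 < l x) ∧ ∃ C, ∀ x ∈ K, |l x| ≤ C := by
  -- enlarge J
  have hhalf : ∀ᶠ j in atTop, ε j ≤ 1 / 2 :=
    (hε.tendsto_atTop_zero.eventually_lt_const (by norm_num : (0 : ℝ) < 1 / 2)).mono fun _ h => h.le
  obtain ⟨J1, hJ1⟩ := eventually_atTop.1 hhalf
  obtain ⟨J2, hJ, hJ1'⟩ : ∃ J2, J ≤ J2 ∧ J1 ≤ J2 := ⟨max J J1, le_max_left _ _, le_max_right _ _⟩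
  obtain ⟨C0, hC0⟩ := hbd J2 hJ
  set S := ∑' j, ε j with hS
  have hpart : ∀ i, ∑ k ∈ Finset.range i, ε (J2 + k) ≤ S := by
    intro i
    have h1 : ∑ k ∈ Finset.range i, ε (J2 + k) = ∑ k ∈ (Finset.range i).map (addLeftEmbedding J2), ε k := by
      simp
    rw [h1]
    exact hε.sum_le_tsum _ fun k _ => hε0 k
  have hS0 : 0 ≤ S := tsum_nonneg hε0
  have up : ∀ i, ∀ x ∈ K, L (J2 + i) x ≤ L J2 x * Real.exp (∑ k ∈ Finset.range i, ε (J2 + k)) := by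
    intro i x hx
    induction i with
    | zero => simp
    | succ i ih =>
      have h1 := (abs_le.1 (hstep (J2 + i) (by omega) x hx)).2
      have h2 := hpos (J2 + i) (by omega) x hx
      have h3 := Real.add_one_le_exp (ε (J2 + i))
      rw [Finset.sum_range_succ, Real.exp_add, ← mul_assoc]
      calc L (J2 + (i + 1)) x ≤ L (J2 + i) x * (ε (J2 + i) + 1) := by
            rw [show J2 + (i + 1) = J2 + i + 1 by ring]; linarith
        _ ≤ L (J2 + i) x * Real.exp (ε (J2 + i)) := by gcongr
        _ ≤ _ := by gcongr
  have low : ∀ i, ∀ x ∈ K,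
      L J2 x * Real.exp (-(2 * ∑ k ∈ Finset.range i, ε (J2 + k))) ≤ L (J2 + i) x := by
    intro i x hx
    induction i with
    | zero => simp
    | succ i ih =>
      have h1 := (abs_le.1 (hstep (J2 + i) (by omega) x hx)).1
      have h2 := hpos (J2 + i) (by omega) x hx
      have h3 := exp_bound (hε0 (J2 + i)) (hJ1 _ (by omega))
      rw [Finset.sum_range_succ, mul_add, neg_add, Real.exp_add, ← mul_assoc]
      calc _ ≤ L (J2 + i) x * Real.exp (-(2 * ε (J2 + i))) := by gcongr
        _ ≤ L (J2 + i) x * (1 - ε (J2 + i)) := by gcongr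
        _ ≤ _ := by
            rw [show J2 + (i + 1) = J2 + i + 1 by ring]; linarith
  set C1 := max C0 0 * Real.exp S with hC1
  have hC1' : 0 ≤ C1 := by positivity
  have upC : ∀ i, ∀ x ∈ K, L (J2 + i) x ≤ C1 := by
    intro i x hx
    refine (up i x hx).trans ?_
    have h1 : L J2 x ≤ max C0 0 := (hC0 x hx).trans (le_max_left _ _)
    have := hpart i
    rw [hC1]
    gcongr
  have hT := tendstoUniformlyOn_tsum_nat (f := fun i x => L (J2 + i + 1) x - L (J2 + i) x) (s := K)
    (u := fun i => C1 * ε (J2 + i)) (((hε.comp_injective (add_right_injective J2)).mul_left C1)) (by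
      intro i x hx
      refine (hstep (J2 + i) (by omega) x hx).trans ?_
      rw [mul_comm]
      exact mul_le_mul_of_nonneg_right (upC i x hx) (hε0 _))
  have htel : ∀ i x, ∑ k ∈ Finset.range i, (L (J2 + k + 1) x - L (J2 + k) x)
      = L (J2 + i) x - L J2 x := by
    intro i x
    exact Finset.sum_range_sub (fun k => L (J2 + k) x) i
  simp only [htel] at hT
  set l : ℝ → ℝ := fun x => L J2 x + ∑' i, (L (J2 + i + 1) x - L (J2 + i) x) with hl
  have hlim : ∀ η > 0, ∃ I, ∀ i ≥ I, ∀ x ∈ K, |L (J2 + i) x - l x| < η := by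
    intro η hη
    obtain ⟨I, hI⟩ := eventually_atTop.1 (Metric.tendstoUniformlyOn_iff.1 hT η hη)
    refine ⟨I, fun i hi x hx => ?_⟩
    have := hI i hi x hx
    rw [Real.dist_eq, abs_sub_comm] at this
    convert this using 2
    simp only [hl]; ring
  have hptw : ∀ x ∈ K, Tendsto (fun i => L (J2 + i) x) atTop (𝓝 (l x)) := by
    intro x hx
    rw [Metric.tendsto_atTop]
    intro η hη
    obtain ⟨I, hI⟩ := hlim η hη
    exact ⟨I, fun i hi => by rw [Real.dist_eq]; exact hI i hi x hx⟩
  have hlpos : ∀ x ∈ K, 0 < l x := by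
    intro x hx
    have h0 : L J2 x * Real.exp (-(2 * S)) ≤ l x := by
      refine ge_of_tendsto (hptw x hx) (Eventually.of_forall fun i => ?_)
      refine le_trans ?_ (low i x hx)
      have := hpart i
      have h2 := (hpos J2 hJ x hx).le
      gcongr
    exact lt_of_lt_of_le (mul_pos (hpos J2 hJ x hx) (Real.exp_pos _)) h0
  refine ⟨l, ?_, hlpos, C1, ?_⟩
  · rw [Metric.tendsto_nhds]
    intro η hη
    rw [eventually_uf]
    obtain ⟨I, hI⟩ := hlim η hη
    refine ⟨J2 + I, fun j hj x hx => ?_⟩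
    rw [dist_zero_right, Real.norm_eq_abs]
    have := hI (j - J2) (by omega) x hx
    rwa [show J2 + (j - J2) = j by omega] at this
  · intro x hx
    rw [abs_of_pos (hlpos x hx)]
    exact le_of_tendsto (hptw x hx) (Eventually.of_forall fun i => upC i x hx)

/-- One step of the approximately invariant form. -/
theorem Q_step {A B C D U V : ℝ} {m m' e : ℂ} {y0 : ℝ} (hy0 : 0 < y0)
    (hdet : 0 < A * D - B * C) (hm : y0 ≤ m.im) (hm' : y0 ≤ m'.im)
    (hP : (A : ℂ) + B * m ≠ 0) (he : e = (C + D * m) / (A + B * m) - m') (hes : ‖e‖ ≤ y0 / 2) :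
    |‖((C * U + D * V : ℝ) : ℂ) - m' * ((A * U + B * V : ℝ) : ℂ)‖ ^ 2 / m'.im
      - (A * D - B * C) * (‖(V : ℂ) - m * U‖ ^ 2 / m.im)| ≤
      (4 / y0 * ‖e‖) * ((A * D - B * C) * (‖(V : ℂ) - m * U‖ ^ 2 / m.im)) := by
  set U' : ℝ := A * U + B * V with hU'
  set V' : ℝ := C * U + D * V with hV'
  set dt := A * D - B * C with hdt
  set P : ℂ := (A : ℂ) + B * m with hPdef
  set M : ℂ := m' + e with hM
  have hMq : M = (C + D * m) / P := by rw [hM, he]; ring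
  have hMP : M * P = C + D * m := by rw [hMq]; field_simp
  set z : ℂ := (V' : ℂ) - M * U' with hz
  have hzP : z * P = dt * ((V : ℂ) - m * U) := by
    have : z * P = V' * P - (M * P) * U' := by rw [hz]; ring
    rw [this, hMP, hU', hV', hPdef, hdt]
    push_cast
    ring
  have hPn : 0 < Complex.normSq P := Complex.normSq_pos.2 hP
  have hMim : M.im * Complex.normSq P = dt * m.im := by
    have h1 : M.im = ((C + D * m) * (starRingEnd ℂ) P).im / Complex.normSq P := by
      rw [hMq, div_eq_mul_inv, Complex.inv_def, ← mul_assoc, Complex.im_mul_ofReal,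
        div_eq_mul_inv]
    rw [h1, div_mul_cancel₀ _ hPn.ne', hPdef, hdt]
    simp
    ring
  have hmim : 0 < m.im := lt_of_lt_of_le hy0 hm
  have hm'im : 0 < m'.im := lt_of_lt_of_le hy0 hm'
  have hMpos : 0 < M.im := by
    by_contra hcon
    push Not at hcon
    have : M.im * Complex.normSq P ≤ 0 := mul_nonpos_of_nonpos_of_nonneg hcon hPn.le
    rw [hMim] at this
    have := mul_pos hdet hmim
    linarith
  have hei : |e.im| ≤ ‖e‖ := Complex.abs_im_le_norm e
  have hMe : M.im = m'.im + e.im := by rw [hM]; simp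
  have hMlow : y0 / 2 ≤ M.im := by
    have := (abs_le.1 hei).1
    rw [hMe]; linarith
  -- Q tilde
  have hQ : dt * (‖(V : ℂ) - m * U‖ ^ 2 / m.im) = ‖z‖ ^ 2 / M.im := by
    have h1 : ‖z‖ ^ 2 * Complex.normSq P = dt ^ 2 * ‖(V : ℂ) - m * U‖ ^ 2 := by
      rw [Complex.normSq_eq_norm_sq, ← mul_pow, ← norm_mul, hzP, norm_mul, mul_pow]
      simp
    rw [← mul_div_assoc, div_eq_div_iff hmim.ne' hMpos.ne']
    have h2 : (dt * ‖(V : ℂ) - m * U‖ ^ 2 * M.im) * (Complex.normSq P * dt) =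
        (‖z‖ ^ 2 * m.im) * (Complex.normSq P * dt) := by
      linear_combination (dt ^ 2 * ‖(V : ℂ) - m * U‖ ^ 2) * hMim - (dt * m.im) * h1
    exact mul_right_cancel₀ (by positivity) h2
  rw [hQ]
  have hUz : |U'| * M.im ≤ ‖z‖ := by
    have h1 : z.im = - (M.im * U') := by rw [hz]; simp
    have := Complex.abs_im_le_norm z
    rw [h1, abs_neg, abs_mul, abs_of_pos hMpos] at this
    linarith
  have hV'z : (V' : ℂ) - m' * U' = z + e * U' := by rw [hz, hM]; ring
  rw [hV'z]
  set ε := ‖e‖ with hε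
  have hε0 : 0 ≤ ε := norm_nonneg e
  have hU2 : ‖e * (U' : ℂ)‖ ≤ ε * (‖z‖ / M.im) := by
    rw [norm_mul, Complex.norm_real, Real.norm_eq_abs]
    gcongr
    rw [le_div_iff₀ hMpos]; exact hUz
  set Z := ‖z‖ with hZ
  have hZ0 : 0 ≤ Z := norm_nonneg z
  set κ := ε / M.im with hκ
  have hκ0 : 0 ≤ κ := by positivity
  have hκ1 : κ ≤ 1 := by rw [hκ, div_le_one hMpos]; linarith
  have hU3 : ‖e * (U' : ℂ)‖ ≤ Z * κ := by
    refine hU2.trans (le_of_eq ?_); rw [hκ]; ring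
  have hκM : κ * M.im = ε := by rw [hκ]; field_simp
  have n1 : ‖z + e * U'‖ ≤ Z * (1 + κ) := by
    have := norm_add_le z (e * U'); linarith
  have n2 : Z * (1 - κ) ≤ ‖z + e * U'‖ := by
    have := norm_sub_norm_le z (-(e * U'))
    rw [sub_neg_eq_add, norm_neg] at this
    linarith
  have s1 : ‖z + e * U'‖ ^ 2 ≤ Z ^ 2 * (1 + 3 * κ) := by
    calc ‖z + e * U'‖ ^ 2 ≤ (Z * (1 + κ)) ^ 2 := by gcongr
      _ = Z ^ 2 * (1 + κ) ^ 2 := by ring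
      _ ≤ _ := by
        have : (1 + κ) ^ 2 ≤ 1 + 3 * κ := by nlinarith
        gcongr
  have s2 : Z ^ 2 * (1 - 3 * κ) ≤ ‖z + e * U'‖ ^ 2 := by
    calc Z ^ 2 * (1 - 3 * κ) ≤ Z ^ 2 * (1 - κ) ^ 2 := by
            have : 1 - 3 * κ ≤ (1 - κ) ^ 2 := by nlinarith
            gcongr
      _ = (Z * (1 - κ)) ^ 2 := by ring
      _ ≤ _ := by
        have : 0 ≤ Z * (1 - κ) := mul_nonneg hZ0 (by linarith)
        gcongr
  have hform : ‖z + e * U'‖ ^ 2 / m'.im - Z ^ 2 / M.im =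
      ((‖z + e * U'‖ ^ 2 - Z ^ 2) * M.im + Z ^ 2 * e.im) / (m'.im * M.im) := by
    rw [hMe]
    have : m'.im + e.im ≠ 0 := by rw [← hMe]; exact hMpos.ne'
    field_simp
    ring
  rw [hform, abs_div, abs_of_pos (mul_pos hm'im hMpos)]
  have num : |(‖z + e * U'‖ ^ 2 - Z ^ 2) * M.im + Z ^ 2 * e.im| ≤ 4 * ε * Z ^ 2 := by
    have h1 : |‖z + e * U'‖ ^ 2 - Z ^ 2| ≤ Z ^ 2 * (3 * κ) := by
      rw [abs_le]; constructor <;> linarith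
    calc _ ≤ |‖z + e * U'‖ ^ 2 - Z ^ 2| * M.im + Z ^ 2 * |e.im| := by
          refine (abs_add_le _ _).trans ?_
          rw [abs_mul, abs_mul, abs_of_pos hMpos, abs_of_nonneg (sq_nonneg Z)]
      _ ≤ Z ^ 2 * (3 * κ) * M.im + Z ^ 2 * ε := by gcongr
      _ = 4 * ε * Z ^ 2 := by rw [← hκM]; ring
  calc _ ≤ 4 * ε * Z ^ 2 / (m'.im * M.im) := by gcongr
    _ ≤ 4 * ε * Z ^ 2 / (y0 * M.im) := by gcongr
    _ = _ := by field_simp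


/-- Solutions of a three-term recurrence. -/
def lrec (α β : ℕ → ℝ) (s0 s1 : ℝ) : ℕ → ℝ
  | 0 => s0
  | 1 => s1
  | (l + 2) => β l * lrec α β s0 s1 (l + 1) - α l * lrec α β s0 s1 l

theorem lrec_det (α β : ℕ → ℝ) (l : ℕ) :
    lrec α β 1 0 l * lrec α β 0 1 (l + 1) - lrec α β 0 1 l * lrec α β 1 0 (l + 1)
      = ∏ i ∈ Finset.range l, α i := by
  induction l with
  | zero => simp [lrec]
  | succ l ih =>
    rw [Finset.prod_range_succ, ← ih]
    simp only [lrec]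
    ring

theorem lrec_unique (α β : ℕ → ℝ) (y : ℕ → ℝ) (hy : ∀ l, y (l + 2) = β l * y (l + 1) - α l * y l)
    (l : ℕ) : y l = lrec α β 1 0 l * y 0 + lrec α β 0 1 l * y 1 := by
  induction l using Nat.strong_induction_on with
  | _ l ih =>
    match l with
    | 0 => simp [lrec]
    | 1 => simp [lrec]
    | (l + 2) =>
      rw [hy, ih l (by omega), ih (l + 1) (by omega)]
      simp only [lrec]
      ring

theorem lrec_tendsto {ι : Type*} {f : Filter ι} (α β : ι → ℕ → ℝ) (α0 β0 : ℝ)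
    (hα : ∀ l, Tendsto (fun i => α i l) f (𝓝 α0)) (hβ : ∀ l, Tendsto (fun i => β i l) f (𝓝 β0))
    (s0 s1 : ℝ) (l : ℕ) :
    Tendsto (fun i => lrec (α i) (β i) s0 s1 l) f
      (𝓝 (lrec (fun _ => α0) (fun _ => β0) s0 s1 l)) := by
  induction l using Nat.strong_induction_on with
  | _ l ih =>
    match l with
    | 0 => simpa [lrec] using tendsto_const_nhds
    | 1 => simpa [lrec] using tendsto_const_nhds
    | (l + 2) =>
      simp only [lrec]
      exact ((hβ l).mul (ih (l + 1) (by omega))).sub ((hα l).mul (ih l (by omega)))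

theorem lrec_WC {r : ℕ} {h : ℕ → ℝ} (hh : Adm r h) {K : Set ℝ} (α β : ℕ × ℝ → ℕ → ℝ) (N : ℕ)
    (hα : ∀ l < N, WC K h 0 r (fun p => α p l)) (hβ : ∀ l < N, WC K h 0 r (fun p => β p l))
    (s0 s1 : ℝ) (l : ℕ) (hl : l ≤ N + 1) :
    WC K h 0 r (fun p => lrec (α p) (β p) s0 s1 l) := by
  induction l using Nat.strong_induction_on with
  | _ l ih =>
    match l with
    | 0 => simpa [lrec] using WC.const r s0
    | 1 => simpa [lrec] using WC.const r s1
    | (l + 2) =>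
      simp only [lrec]
      exact ((hβ l (by omega)).mul0 hh (ih (l + 1) (by omega) (by omega))).sub
        ((hα l (by omega)).mul0 hh (ih l (by omega) (by omega)))

theorem lrec_pow {q : ℝ} {t : ℂ} (ht : t ^ 2 = -q * t - 1) (l : ℕ) :
    ((lrec (fun _ => 1) (fun _ => -q) 1 0 l : ℝ) : ℂ) +
      (lrec (fun _ => 1) (fun _ => -q) 0 1 l : ℝ) * t = t ^ l := by
  induction l using Nat.strong_induction_on with
  | _ l ih =>
    match l with
    | 0 => simp [lrec]
    | 1 => simp [lrec]
    | (l + 2) =>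
      have h1 := ih (l + 1) (by omega)
      have h0 := ih l (by omega)
      rw [pow_add, ht]
      simp only [lrec]
      push_cast
      linear_combination (-(q : ℂ)) * h1 - h0

theorem rootpow_ne {N : ℕ} (hN : 0 < N) {q : ℝ} (hq2 : |q| < 2)
    (hqcos : ∀ j : ℕ, 1 ≤ j → j < N → q ≠ 2 * Real.cos (j * π / N)) {t : ℂ}
    (htre : t.re = -q / 2) (htim : t.im = Real.sqrt (4 - q ^ 2) / 2) : (t ^ N) ^ 2 ≠ 1 := by
  obtain ⟨hq1, hq3⟩ := abs_lt.1 hq2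
  set θ := Real.arccos (-q / 2) with hθ
  have hθ0 : 0 < θ := Real.arccos_pos.2 (by linarith)
  have hcos : Real.cos θ = -q / 2 := Real.cos_arccos (by linarith) (by linarith)
  have hθπ : θ < π := by
    refine lt_of_le_of_ne (Real.arccos_le_pi _) fun h => ?_
    rw [h, Real.cos_pi] at hcos; linarith
  have hsin : Real.sin θ = Real.sqrt (4 - q ^ 2) / 2 := by
    rw [hθ, Real.sin_arccos]
    rw [show 1 - (-q / 2) ^ 2 = (4 - q ^ 2) / 2 ^ 2 by ring, Real.sqrt_div' _ (by positivity),
      Real.sqrt_sq (by norm_num)]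
  have ht : t = Complex.exp (θ * Complex.I) := by
    apply Complex.ext
    · rw [Complex.exp_ofReal_mul_I_re, hcos, htre]
    · rw [Complex.exp_ofReal_mul_I_im, hsin, htim]
  intro h1
  rw [← pow_mul, ht, ← Complex.exp_nat_mul, Complex.exp_eq_one_iff] at h1
  obtain ⟨n, hn⟩ := h1
  have hNr : (0 : ℝ) < N := by exact_mod_cast hN
  have h2 : (N : ℝ) * θ = n * π := by
    have h3 := congrArg Complex.im hn
    simp at h3
    linarith
  have hnpos : 0 < n := by
    have : (0 : ℝ) < n * π := by rw [← h2]; positivity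
    have := (mul_pos_iff_of_pos_right Real.pi_pos).1 this
    exact_mod_cast this
  have hnN : n < N := by
    have : (n : ℝ) * π < N * π := by rw [← h2]; gcongr
    have := lt_of_mul_lt_mul_right this Real.pi_pos.le
    exact_mod_cast this
  obtain ⟨k, rfl⟩ := Int.eq_ofNat_of_zero_le hnpos.le
  have hk1 : 0 < k := by exact_mod_cast hnpos
  have hk2 : k < N := by exact_mod_cast hnN
  refine hqcos (N - k) (by omega) (by omega) ?_
  rw [Nat.cast_sub hk2.le]
  have : ((N : ℝ) - k) * π / N = π - θ := by
    have h2' : (N : ℝ) * θ = k * π := by simpa using h2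
    field_simp
    linarith
  rw [this, Real.cos_pi_sub, hcos]
  ring

/-- The Turan-type form. -/
def FF (a b : ℕ → ℝ) (q : ℝ) (n : ℕ) (x : ℝ) : ℝ :=
  a n * (opoly a b (n + 1) x ^ 2 + q * opoly a b n x * opoly a b (n + 1) x + opoly a b n x ^ 2)

theorem opoly_rec (a b : ℕ → ℝ) (n : ℕ) (x : ℝ) : opoly a b (n + 2) x =
    (x - b (n + 1)) / a (n + 1) * opoly a b (n + 1) x - a n / a (n + 1) * opoly a b n x := by
  simp only [opoly]; ring

theorem opoly_continuous (a b : ℕ → ℝ) (n : ℕ) : Continuous (opoly a b n) := by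
  induction n using Nat.strong_induction_on with
  | _ n ih =>
    match n with
    | 0 => simpa [opoly] using continuous_const
    | 1 => simp only [opoly]; fun_prop
    | (n + 2) =>
      have h1 := ih (n + 1) (by omega)
      have h0 := ih n (by omega)
      simp only [opoly]
      fun_prop

theorem opoly_nonzero {a b : ℕ → ℝ} (ha : ∀ n, 0 < a n) (x : ℝ) (n : ℕ) :
    ¬ (opoly a b n x = 0 ∧ opoly a b (n + 1) x = 0) := by
  induction n with
  | zero => simp [opoly]
  | succ n ih =>
    rintro ⟨h1, h2⟩
    rw [opoly_rec, h1] at h2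
    have h3 : a n / a (n + 1) ≠ 0 := (div_pos (ha n) (ha _)).ne'
    have : opoly a b n x = 0 := by
      have : a n / a (n + 1) * opoly a b n x = 0 := by linarith
      exact (mul_eq_zero.1 this).resolve_left h3
    exact ih ⟨this, h1⟩

theorem form_lower {q u v : ℝ} :
    (1 - |q| / 2) * (u ^ 2 + v ^ 2) ≤ v ^ 2 + q * u * v + u ^ 2 := by
  have h1 : -(|q| * |u * v|) ≤ q * u * v := by
    rw [← abs_mul, mul_assoc]; exact neg_abs_le _
  have h2 : |u * v| ≤ (u ^ 2 + v ^ 2) / 2 := by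
    rw [abs_mul]; nlinarith [sq_abs u, sq_abs v, sq_nonneg (|u| - |v|)]
  nlinarith [abs_nonneg q]

theorem form_pos {q u v : ℝ} (hq : |q| < 2) (h : ¬ (u = 0 ∧ v = 0)) :
    0 < v ^ 2 + q * u * v + u ^ 2 := by
  refine lt_of_lt_of_le ?_ form_lower
  refine mul_pos (by linarith) ?_
  by_cases hu : u = 0
  · have hv : v ≠ 0 := fun hv => h ⟨hu, hv⟩
    positivity
  · positivity

theorem FF_pos {a b : ℕ → ℝ} (ha : ∀ n, 0 < a n) {q : ℝ} (hq : |q| < 2) (n : ℕ) (x : ℝ) :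
    0 < FF a b q n x := mul_pos (ha n) (form_pos hq (opoly_nonzero ha x n))

theorem FF_continuous (a b : ℕ → ℝ) (q : ℝ) (n : ℕ) : Continuous (FF a b q n) := by
  have := opoly_continuous a b n
  have := opoly_continuous a b (n + 1)
  unfold FF; fun_prop

theorem bdd_mul_zero {K : Set ℝ} {ρ : ℕ × ℝ → ℝ} {φ : ℝ → ℝ}
    (hφ : ∃ C, ∀ x ∈ K, |φ x| ≤ C) (hρ : Tendsto ρ (uf K) (𝓝 0)) :
    Tendsto (fun p : ℕ × ℝ => φ p.2 * ρ p) (uf K) (𝓝 0) := by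
  have := unif_mul (f := fun p => φ p.2) (g := φ) (by simpa using tendsto_const_nhds) hφ hρ
  simpa using this

theorem beta_tendsto {a b : ℕ → ℝ} {q : ℝ} (hq : Tendsto (fun n : ℕ => b n / a n) atTop (𝓝 q))
    (hdiv : Tendsto a atTop atTop) {K : Set ℝ} (hK : ∃ C, ∀ x ∈ K, |x| ≤ C) {e : ℕ → ℕ}
    (he : Tendsto e atTop atTop) :
    Tendsto (fun p : ℕ × ℝ => (p.2 - b (e p.1)) / a (e p.1)) (uf K) (𝓝 (-q)) := by
  have he' : Tendsto (fun p : ℕ × ℝ => e p.1) (uf K) atTop := he.comp tendsto_fst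
  have h1 := bdd_mul_zero (φ := fun x => x) hK ((tendsto_inv_atTop_zero.comp hdiv).comp he')
  have h2 := h1.sub (hq.comp he')
  rw [zero_sub] at h2
  refine h2.congr fun p => ?_
  simp only [Function.comp]; ring

theorem FF_ratio {a b : ℕ → ℝ} (ha : ∀ n, 0 < a n) {q : ℝ} (hq2 : |q| < 2)
    (hratio : Tendsto (fun n : ℕ => a n / a (n + 1)) atTop (𝓝 1))
    (hq : Tendsto (fun n : ℕ => b n / a n) atTop (𝓝 q))
    (hdiv : Tendsto a atTop atTop) {K : Set ℝ} (hK : ∃ C, ∀ x ∈ K, |x| ≤ C) :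
    Tendsto (fun p : ℕ × ℝ => FF a b q (p.1 + 1) p.2 / FF a b q p.1 p.2) (uf K) (𝓝 1) := by
  set β : ℕ × ℝ → ℝ := fun p => (p.2 - b (p.1 + 1)) / a (p.1 + 1)
  set α : ℕ × ℝ → ℝ := fun p => a p.1 / a (p.1 + 1)
  have hβ : Tendsto β (uf K) (𝓝 (-q)) :=
    beta_tendsto (e := fun n => n + 1) hq hdiv hK (tendsto_add_atTop_nat 1)
  have hα : Tendsto α (uf K) (𝓝 1) := hratio.comp tendsto_fst
  set η : ℕ × ℝ → ℝ := fun p => |β p + q| + |1 - α p| with hη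
  have hηl : Tendsto η (uf K) (𝓝 0) := by
    have h1 : Tendsto (fun p => β p + q) (uf K) (𝓝 0) := by simpa using hβ.add_const q
    have h2 : Tendsto (fun p => 1 - α p) (uf K) (𝓝 0) := by simpa using hα.const_sub 1
    simpa using h1.abs.add h2.abs
  set c := 1 - |q| / 2 with hc
  have hc0 : 0 < c := by rw [hc]; linarith
  have hbound : Tendsto (fun p => 2 * η p * (4 + η p) / c) (uf K) (𝓝 0) := by
    have := (((hηl.const_mul 2).mul (hηl.const_add 4)).div_const c)
    simpa using this
  set G : ℕ × ℝ → ℝ := fun p => α p * (FF a b q (p.1 + 1) p.2 / FF a b q p.1 p.2) - 1 with hG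
  have hGl : Tendsto G (uf K) (𝓝 0) := by
    refine squeeze_zero_norm (fun p => ?_) hbound
    set u := opoly a b p.1 p.2 with hu
    set v := opoly a b (p.1 + 1) p.2 with hv
    set φ := v ^ 2 + q * u * v + u ^ 2 with hφ
    have hφ0 : 0 < φ := form_pos hq2 (opoly_nonzero ha p.2 p.1)
    have hφl : c * (u ^ 2 + v ^ 2) ≤ φ := form_lower
    set δ := (β p + q) * v + (1 - α p) * u with hδ
    have hw : opoly a b (p.1 + 2) p.2 = -q * v - u + δ := by
      rw [opoly_rec, hδ]; simp only [β, α]; ring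
    have hGp : G p = δ * (-q * v - 2 * u + δ) / φ := by
      have e1 : FF a b q p.1 p.2 = a p.1 * φ := rfl
      have e2 : FF a b q (p.1 + 1) p.2 = a (p.1 + 1) *
          ((-q * v - u + δ) ^ 2 + q * v * (-q * v - u + δ) + v ^ 2) := by
        unfold FF; rw [show p.1 + 1 + 1 = p.1 + 2 by ring, hw]
      simp only [hG, e1, e2, α]
      have h1 := (ha p.1).ne'
      have h2 := (ha (p.1 + 1)).ne'
      field_simp
      rw [hφ]; ring
    have hη0 : 0 ≤ η p := by positivity
    have hδb : |δ| ≤ η p * (|u| + |v|) := by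
      calc |δ| ≤ |β p + q| * |v| + |1 - α p| * |u| := by
            rw [hδ, ← abs_mul, ← abs_mul]; exact abs_add_le _ _
        _ ≤ _ := by
            simp only [hη]
            nlinarith [mul_nonneg (abs_nonneg (β p + q)) (abs_nonneg u),
              mul_nonneg (abs_nonneg (1 - α p)) (abs_nonneg v)]
    have h2 : |-q * v - 2 * u + δ| ≤ (4 + η p) * (|u| + |v|) := by
      calc _ ≤ |q| * |v| + 2 * |u| + |δ| := by
            refine (abs_add_le _ _).trans ?_
            gcongr
            refine (abs_sub _ _).trans ?_
            rw [abs_mul, abs_mul, abs_neg]; simp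
        _ ≤ _ := by nlinarith [abs_nonneg u, abs_nonneg v]
    have h3 : (|u| + |v|) ^ 2 ≤ 2 * (u ^ 2 + v ^ 2) := by
      nlinarith [sq_abs u, sq_abs v, sq_nonneg (|u| - |v|)]
    rw [Real.norm_eq_abs, hGp, abs_div, abs_mul, abs_of_pos hφ0, div_le_div_iff₀ hφ0 hc0]
    calc |δ| * |-q * v - 2 * u + δ| * c
        ≤ (η p * (|u| + |v|)) * ((4 + η p) * (|u| + |v|)) * c := by gcongr
      _ = η p * (4 + η p) * (|u| + |v|) ^ 2 * c := by ring
      _ ≤ η p * (4 + η p) * (2 * (u ^ 2 + v ^ 2)) * c := by gcongr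
      _ = 2 * η p * (4 + η p) * (c * (u ^ 2 + v ^ 2)) := by ring
      _ ≤ _ := by gcongr
  have hfin : Tendsto (fun p => (G p + 1) / α p) (uf K) (𝓝 ((0 + 1) / 1)) :=
    (hGl.add_const 1).div hα one_ne_zero
  rw [zero_add, div_one] at hfin
  refine hfin.congr fun p => ?_
  have h1 : α p ≠ 0 := (div_pos (ha _) (ha _)).ne'
  simp only [hG]
  field_simp
  ring


theorem base_conv
    (N' : ℕ) (r : ℕ) (hr : 1 ≤ r)
    (a b : ℕ → ℝ) (ha : ∀ n, 0 < a n) (q : ℝ)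
    (hD1 : ∀ i < N' + 1, memD r (fun j => a ((j + 1) * (N' + 1) + i - 1) / a ((j + 1) * (N' + 1) + i)))
    (hD2 : ∀ i < N' + 1, memD r (fun j => b (j * (N' + 1) + i) / a (j * (N' + 1) + i)))
    (hD3 : ∀ i < N' + 1, memD r (fun j => 1 / a (j * (N' + 1) + i)))
    (hratio : Tendsto (fun n : ℕ => a n / a (n + 1)) atTop (𝓝 1))
    (hq : Tendsto (fun n : ℕ => b n / a n) atTop (𝓝 q))
    (hdiv : Tendsto a atTop atTop)
    (hq2 : |q| < 2)
    (hqcos : ∀ j : ℕ, 1 ≤ j → j < N' + 1 → q ≠ 2 * Real.cos (j * π / (N' + 1 : ℕ)))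
    {K : Set ℝ} (hKc : IsCompact K) :
    ∃ g : ℝ → ℝ, Tendsto (fun p : ℕ × ℝ => FF a b q (p.1 * (N' + 1) + N') p.2 - g p.2) (uf K) (𝓝 0) ∧
      (∀ x ∈ K, 0 < g x) ∧ ∃ C, ∀ x ∈ K, |g x| ≤ C := by
  have hK : ∃ C, ∀ x ∈ K, |x| ≤ C := hKc.exists_bound_of_continuousOn (f := fun x => x) continuousOn_id
  set N := N' + 1 with hN
  set e : ℕ → ℕ := fun j => j * N + N' with he
  have helim : Tendsto e atTop atTop := by
    refine tendsto_atTop_mono (fun j => ?_) tendsto_id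
    simp only [he, id]; nlinarith [Nat.zero_le N', Nat.zero_le j]
  have helim' : ∀ l, Tendsto (fun j => e j + l) atTop atTop := fun l =>
    tendsto_atTop_mono (fun j => Nat.le_add_right _ _) helim
  set α : ℕ × ℝ → ℕ → ℝ := fun p l => a (e p.1 + l) / a (e p.1 + l + 1) with hα
  set β : ℕ × ℝ → ℕ → ℝ := fun p l => (p.2 - b (e p.1 + l + 1)) / a (e p.1 + l + 1) with hβ
  have lα : ∀ l, Tendsto (fun p => α p l) (uf K) (𝓝 1) := fun l =>
    (hratio.comp (helim' l)).comp tendsto_fst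
  have lβ : ∀ l, Tendsto (fun p => β p l) (uf K) (𝓝 (-q)) := fun l =>
    beta_tendsto (e := fun j => e j + l + 1) hq hdiv hK
      (helim' (l + 1))
  -- majorant
  obtain ⟨h, hh, hW⟩ := exists_adm hr (Finset.range 3 ×ˢ Finset.range N)
    (fun i => if i.1 = 0 then (fun j => a ((j + 1) * N + i.2 - 1) / a ((j + 1) * N + i.2))
      else if i.1 = 1 then (fun j => b (j * N + i.2) / a (j * N + i.2))
      else (fun j => 1 / a (j * N + i.2))) (by
      rintro ⟨i, l⟩ hil
      simp only [Finset.mem_product, Finset.mem_range] at hil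
      obtain ⟨hi, hl⟩ := hil
      interval_cases i
      · simpa using hD1 l hl
      · simpa using hD2 l hl
      · simpa using hD3 l hl)
  have hW1 : ∀ l < N, WC K h 0 r (fun p : ℕ × ℝ => a ((p.1 + 1) * N + l - 1) / a ((p.1 + 1) * N + l)) :=
    fun l hl => by simpa using hW K (0, l) (by simp [hl])
  have hW2 : ∀ l < N, WC K h 0 r (fun p : ℕ × ℝ => b (p.1 * N + l) / a (p.1 * N + l)) :=
    fun l hl => by simpa using hW K (1, l) (by simp [hl])
  have hW3 : ∀ l < N, WC K h 0 r (fun p : ℕ × ℝ => 1 / a (p.1 * N + l)) :=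
    fun l hl => by simpa using hW K (2, l) (by simp [hl])
  have hidx : ∀ j l, (j + 1) * N + l = e j + l + 1 := by
    intro j l; simp only [he, hN]; ring
  have wα : ∀ l < N, WC K h 0 r (fun p => α p l) := by
    intro l hl
    have := hW1 l hl
    simpa only [hidx, Nat.add_sub_cancel] using this
  have wβ : ∀ l < N, WC K h 0 r (fun p => β p l) := by
    intro l hl
    have h2 := (hW2 l hl).shift hh
    have h3 := (hW3 l hl).shift hh
    have h4 := ((WC.of_const_j r (fun x : ℝ => x) hK).mul0 hh h3).sub h2
    convert h4 using 1
    ext p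
    simp only [shf, Pi.sub_apply, Pi.mul_apply, hidx, hβ]
    ring
  -- limit data
  set t : ℂ := ⟨-q / 2, Real.sqrt (4 - q ^ 2) / 2⟩ with ht
  have hq4 : 0 < 4 - q ^ 2 := by
    have := sq_lt_sq' (abs_lt.1 hq2).1 (abs_lt.1 hq2).2
    linarith
  have htim : 0 < t.im := by simp only [ht]; positivity
  have hsq : Real.sqrt (4 - q ^ 2) ^ 2 = 4 - q ^ 2 := Real.sq_sqrt hq4.le
  have htre : t.re = -q / 2 := rfl
  have htim' : t.im = Real.sqrt (4 - q ^ 2) / 2 := rfl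
  have htn : t.re ^ 2 + t.im ^ 2 = 1 := by rw [htre, htim']; linear_combination hsq / 4
  have ht2 : t ^ 2 = -q * t - 1 := by
    apply Complex.ext
    · have e1 : (t ^ 2).re = t.re ^ 2 - t.im ^ 2 := by
        rw [pow_two t, Complex.mul_re]; ring
      have e2 : (-(q : ℂ) * t - 1).re = -q * t.re - 1 := by simp
      rw [e1, e2, htre, htim']; linear_combination -hsq / 4
    · simp [pow_two, htre, htim']; ring
  have htnorm : ‖t‖ = 1 := by
    rw [← sq_eq_sq₀ (norm_nonneg _) zero_le_one, ← Complex.normSq_eq_norm_sq, Complex.normSq_apply]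
    linear_combination htn
  have hl1 := rootpow_ne (N := N) (by omega) hq2 hqcos htre htim'
  have hl0 : t ^ N ≠ 0 := by
    apply pow_ne_zero
    intro h0; rw [h0] at htnorm; simp at htnorm
  set A : ℕ × ℝ → ℝ := fun p => lrec (α p) (β p) 1 0 N with hA
  set B : ℕ × ℝ → ℝ := fun p => lrec (α p) (β p) 0 1 N with hB
  set C : ℕ × ℝ → ℝ := fun p => lrec (α p) (β p) 1 0 (N + 1) with hC
  set D : ℕ × ℝ → ℝ := fun p => lrec (α p) (β p) 0 1 (N + 1) with hD
  have hp1 := lrec_pow ht2 N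
  have hp2 := lrec_pow ht2 (N + 1)
  have hB0 : lrec (fun _ => 1) (fun _ => -q) 0 1 N ≠ 0 := by
    intro h0
    rw [h0] at hp1
    simp only [Complex.ofReal_zero, zero_mul, add_zero] at hp1
    apply hl1
    have h2 := congrArg norm hp1
    rw [norm_pow, htnorm, one_pow, Complex.norm_real, Real.norm_eq_abs] at h2
    rw [← hp1, ← Complex.ofReal_pow, ← sq_abs, h2]
    simp
  obtain ⟨m, lm, hres⟩ := newton hr hh (K := K) (t := t) (lam := t ^ N)
    (lrec_tendsto α β 1 (-q) lα lβ 1 0 N) (lrec_tendsto α β 1 (-q) lα lβ 0 1 N)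
    (lrec_tendsto α β 1 (-q) lα lβ 1 0 (N + 1)) (lrec_tendsto α β 1 (-q) lα lβ 0 1 (N + 1))
    htim hB0 hp1 (by rw [hp2, pow_succ]) (by rw [lrec_det]; simp) hl0 hl1
    (lrec_WC hh α β N wα wβ 1 0 N (by omega)) (lrec_WC hh α β N wα wβ 0 1 N (by omega))
    (lrec_WC hh α β N wα wβ 1 0 (N + 1) le_rfl) (lrec_WC hh α β N wα wβ 0 1 (N + 1) le_rfl)
  set E := resid (fun p => (A p : ℂ)) (fun p => (B p : ℂ)) (fun p => (C p : ℂ)) (fun p => (D p : ℂ)) m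
    with hE
  set U : ℕ × ℝ → ℝ := fun p => opoly a b (e p.1) p.2 with hU
  set V : ℕ × ℝ → ℝ := fun p => opoly a b (e p.1 + 1) p.2 with hV
  have hsol : ∀ p l, opoly a b (e p.1 + l) p.2 = lrec (α p) (β p) 1 0 l * U p
      + lrec (α p) (β p) 0 1 l * V p := by
    intro p l
    exact lrec_unique (α p) (β p) (fun l => opoly a b (e p.1 + l) p.2)
      (fun l => opoly_rec a b (e p.1 + l) p.2) l
  have hes : ∀ j, e (j + 1) = e j + N := by intro j; simp only [he]; ring
  have hU1 : ∀ j x, U (j + 1, x) = A (j, x) * U (j, x) + B (j, x) * V (j, x) := by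
    intro j x
    have := hsol (j, x) N
    simp only [← hes] at this
    exact this
  have hV1 : ∀ j x, V (j + 1, x) = C (j, x) * U (j, x) + D (j, x) * V (j, x) := by
    intro j x
    have := hsol (j, x) (N + 1)
    simp only [← add_assoc, ← hes] at this
    exact this
  have hdet : ∀ p : ℕ × ℝ, A p * D p - B p * C p = a (e p.1) / a (e (p.1 + 1)) := by
    intro p
    rw [hes]
    simp only [hA, hB, hC, hD]
    rw [lrec_det]
    have : ∀ n, ∏ i ∈ Finset.range n, α p i = a (e p.1) / a (e p.1 + n) := by
      intro n
      induction n with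
      | zero => simp [(ha _).ne']
      | succ n ih =>
        rw [Finset.prod_range_succ, ih]
        simp only [hα]
        have h1 := (ha (e p.1 + n)).ne'
        have h2 := (ha (e p.1 + n + 1)).ne'
        rw [← add_assoc]
        field_simp
    exact this N
  -- the conserved quantity
  set L : ℕ → ℝ → ℝ := fun j x => a (e j) * (‖(V (j, x) : ℂ) - m (j, x) * U (j, x)‖ ^ 2 / (m (j, x)).im)
    with hL
  obtain ⟨C1, hC1⟩ := hres.bound
  have lmim : Tendsto (fun p => (m p).im) (uf K) (𝓝 t.im) := (Complex.continuous_im.tendsto _).comp lm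
  set y0 := t.im / 2 with hy0
  have hy0p : 0 < y0 := by rw [hy0]; linarith
  have ev1 : ∀ᶠ p in uf K, y0 ≤ (m p).im :=
    (lmim.eventually_const_lt (by rw [hy0]; linarith : y0 < t.im)).mono fun _ h => h.le
  have lP : Tendsto (fun p => (A p : ℂ) + B p * m p) (uf K) (𝓝 (t ^ N)) := by
    rw [← hp1]
    exact ((Complex.continuous_ofReal.tendsto _).comp (lrec_tendsto α β 1 (-q) lα lβ 1 0 N)).add
      (((Complex.continuous_ofReal.tendsto _).comp (lrec_tendsto α β 1 (-q) lα lβ 0 1 N)).mul lm)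
  have hE0 : Tendsto E (uf K) (𝓝 0) := by
    refine hres.trans_tendsto ?_
    have := (WC.h_lim (K := K) hh).pow r
    rwa [zero_pow (by omega)] at this
  have ev3 : ∀ᶠ p in uf K, ‖E p‖ ≤ y0 / 2 := by
    have h1 := hE0.norm
    rw [norm_zero] at h1
    exact (h1.eventually_lt_const (by linarith : (0 : ℝ) < y0 / 2)).mono fun _ h => h.le
  have lmn : Tendsto (fun p => ‖m p‖) (uf K) (𝓝 1) := by
    have := lm.norm; rwa [htnorm] at this
  have ev4 : ∀ᶠ p in uf K, ‖m p‖ ≤ 2 :=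
    (lmn.eventually_lt_const (by norm_num : (1 : ℝ) < 2)).mono fun _ h => h.le
  obtain ⟨J, hJ⟩ := eventually_uf.1 (ev1.and (((tendsto_shift K).eventually ev1).and
    ((lP.eventually_ne hl0).and (ev3.and (hC1.and ev4)))))
  have hVU : ∀ j x, ¬ (U (j, x) = 0 ∧ V (j, x) = 0) := fun j x => opoly_nonzero ha x (e j)
  have hUz : ∀ j ≥ J, ∀ x ∈ K, |U (j, x)| * (m (j, x)).im ≤ ‖(V (j, x) : ℂ) - m (j, x) * U (j, x)‖ := by
    intro j hj x hx
    obtain ⟨g1, _⟩ := hJ j hj x hx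
    have h1 : ((V (j, x) : ℂ) - m (j, x) * U (j, x)).im = - ((m (j, x)).im * U (j, x)) := by simp
    have := Complex.abs_im_le_norm ((V (j, x) : ℂ) - m (j, x) * U (j, x))
    rw [h1, abs_neg, abs_mul, abs_of_pos (by linarith : 0 < (m (j, x)).im)] at this
    linarith
  have hzpos : ∀ j ≥ J, ∀ x ∈ K, 0 < ‖(V (j, x) : ℂ) - m (j, x) * U (j, x)‖ := by
    intro j hj x hx
    obtain ⟨g1, _⟩ := hJ j hj x hx
    rw [norm_pos_iff]
    intro h0
    have h2 := hUz j hj x hx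
    rw [h0, norm_zero] at h2
    have h3 : U (j, x) = 0 := by
      have : |U (j, x)| ≤ 0 := by
        by_contra hc
        push Not at hc
        have := mul_pos hc (by linarith : 0 < (m (j, x)).im)
        linarith
      exact abs_nonpos_iff.1 this
    rw [h3] at h0
    simp at h0
    exact hVU j x ⟨h3, h0⟩
  have hLpos : ∀ j ≥ J, ∀ x ∈ K, 0 < L j x := by
    intro j hj x hx
    obtain ⟨g1, _⟩ := hJ j hj x hx
    have h1 := hzpos j hj x hx
    have h2 : 0 < (m (j, x)).im := by linarith
    have h3 := ha (e j)
    simp only [hL]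
    positivity
  set ε : ℕ → ℝ := fun j => 4 / y0 * (|C1| * h j ^ r) with hε
  obtain ⟨l, hl, hlpos, hlbd⟩ := conv_pos (K := K) (L := L) (ε := ε)
    ((hh.summ.mul_left _).mul_left _)
    (fun j => by have := hh.nonneg j; simp only [hε]; positivity) J hLpos (by
      intro j hj x hx
      obtain ⟨g1, g2, g3, g4, g5, g6⟩ := hJ j hj x hx
      have hd := hdet (j, x)
      have hd0 : 0 < A (j, x) * D (j, x) - B (j, x) * C (j, x) := by
        rw [hd]; exact div_pos (ha _) (ha _)
      have hQ := Q_step (U := U (j, x)) (V := V (j, x)) hy0p hd0 g1 g2 g3 rfl g4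
      rw [← hU1, ← hV1] at hQ
      have hanext := ha (e (j + 1))
      have hanext' := (ha (e (j + 1))).ne'
      have hdd : a (e (j + 1)) * (A (j, x) * D (j, x) - B (j, x) * C (j, x)) = a (e j) := by
        rw [hd]; field_simp
      have h1 : L (j + 1) x - L j x = a (e (j + 1)) *
          (‖(V (j + 1, x) : ℂ) - m (j + 1, x) * (U (j + 1, x) : ℂ)‖ ^ 2 / (m (j + 1, x)).im
            - (A (j, x) * D (j, x) - B (j, x) * C (j, x)) *
              (‖(V (j, x) : ℂ) - m (j, x) * (U (j, x) : ℂ)‖ ^ 2 / (m (j, x)).im)) := by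
        simp only [hL]
        rw [← hdd]
        ring
      rw [h1, abs_mul, abs_of_pos hanext]
      have hee : ‖E (j, x)‖ ≤ |C1| * h j ^ r := by
        refine g5.trans ?_
        rw [Real.norm_of_nonneg (pow_nonneg (hh.nonneg j) r)]
        exact mul_le_mul_of_nonneg_right (le_abs_self _) (pow_nonneg (hh.nonneg j) r)
      calc _ ≤ a (e (j + 1)) * ((4 / y0 * ‖E (j, x)‖) *
              ((A (j, x) * D (j, x) - B (j, x) * C (j, x)) *
              (‖(V (j, x) : ℂ) - m (j, x) * (U (j, x) : ℂ)‖ ^ 2 / (m (j, x)).im))) :=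
            mul_le_mul_of_nonneg_left hQ hanext.le
        _ = (4 / y0 * ‖E (j, x)‖) * L j x := by
            simp only [hL]; rw [← hdd]; ring
        _ ≤ ε j * L j x := by
            have := (hLpos j hj x hx).le
            simp only [hε]
            gcongr) (by
      intro j hj
      have cU : Continuous fun x => U (j, x) := opoly_continuous a b (e j)
      have cV : Continuous fun x => V (j, x) := opoly_continuous a b (e j + 1)
      obtain ⟨CU, hCU⟩ := hKc.exists_bound_of_continuousOn cU.continuousOn
      obtain ⟨CV, hCV⟩ := hKc.exists_bound_of_continuousOn cV.continuousOn
      refine ⟨a (e j) * ((CV + 2 * CU) ^ 2 / y0), fun x hx => ?_⟩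
      obtain ⟨g1, g2, g3, g4, g5, g6⟩ := hJ j hj x hx
      have h3 := ha (e j)
      have hb : ‖(V (j, x) : ℂ) - m (j, x) * U (j, x)‖ ≤ CV + 2 * CU := by
        refine (norm_sub_le _ _).trans ?_
        rw [norm_mul, Complex.norm_real, Complex.norm_real]
        have := hCU x hx
        have := hCV x hx
        gcongr
      simp only [hL]
      gcongr)
  -- compare with FF
  set ρ : ℕ × ℝ → ℝ := fun p => (m p).im * (‖(V p : ℂ) - t * U p‖ ^ 2 / ‖(V p : ℂ) - m p * U p‖ ^ 2)
    with hρ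
  have hFF : ∀ j x, FF a b q (e j) x = a (e j) * ‖(V (j, x) : ℂ) - t * U (j, x)‖ ^ 2 := by
    intro j x
    unfold FF
    congr 1
    rw [← Complex.normSq_eq_norm_sq, Complex.normSq_apply]
    simp [htre, htim', hU, hV]
    linear_combination (-(opoly a b (e j) x) ^ 2 / 4) * hsq
  have lρ : Tendsto ρ (uf K) (𝓝 t.im) := by
    have hw : Tendsto (fun p => ‖((V p : ℂ) - t * U p) / ((V p : ℂ) - m p * U p)‖) (uf K) (𝓝 1) := by
      have h1 : Tendsto (fun p => ((V p : ℂ) - t * U p) / ((V p : ℂ) - m p * U p) - 1) (uf K) (𝓝 0) := by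
        have hbd : Tendsto (fun p => ‖m p - t‖ * y0⁻¹) (uf K) (𝓝 0) := by
          have : Tendsto (fun p => m p - t) (uf K) (𝓝 0) := by
            simpa using lm.sub_const t
          simpa using this.norm.mul_const y0⁻¹
        refine squeeze_zero_norm' ?_ hbd
        rw [eventually_uf]
        refine ⟨J, fun j hj x hx => ?_⟩
        have h1 := hzpos j hj x hx
        have h1' := norm_pos_iff.1 h1
        have h2 := hUz j hj x hx
        obtain ⟨g1, _⟩ := hJ j hj x hx
        have : ((V (j, x) : ℂ) - t * U (j, x)) / ((V (j, x) : ℂ) - m (j, x) * U (j, x)) - 1 =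
            (m (j, x) - t) * (U (j, x) / ((V (j, x) : ℂ) - m (j, x) * U (j, x))) := by
          rw [div_sub_one h1', mul_div_assoc']; congr 1; ring
        rw [this, norm_mul, norm_div, Complex.norm_real, Real.norm_eq_abs]
        gcongr
        rw [div_le_iff₀ h1, inv_mul_eq_div, le_div_iff₀ hy0p]
        refine le_trans ?_ h2
        gcongr
      have h2 := (h1.add_const 1).norm
      simpa using h2
    have h3 := lmim.mul (hw.pow 2)
    rw [one_pow, mul_one] at h3
    refine h3.congr fun p => ?_
    simp only [hρ, norm_div, div_pow]
  refine ⟨fun x => t.im * l x, ?_, fun x hx => mul_pos htim (hlpos x hx), ?_⟩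
  · have := unif_mul hl hlbd lρ
    refine this.congr' ?_
    rw [EventuallyEq, eventually_uf]
    refine ⟨J, fun j hj x hx => ?_⟩
    have h1 := (hzpos j hj x hx).ne'
    obtain ⟨g1, _⟩ := hJ j hj x hx
    have h2 : (m (j, x)).im ≠ 0 := by linarith
    have h4 := hFF j x
    simp only [he] at h4
    simp only
    rw [h4]
    congr 1
    simp only [hL, hρ]
    field_simp
    exact mul_comm _ _
  · obtain ⟨Cl, hCl⟩ := hlbd
    refine ⟨t.im * Cl, fun x hx => ?_⟩
    rw [abs_mul, abs_of_pos htim]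
    have := hCl x hx
    gcongr

theorem thmA_K
    (N' : ℕ) (r : ℕ) (hr : 1 ≤ r)
    (a b : ℕ → ℝ) (ha : ∀ n, 0 < a n) (q : ℝ)
    (hD1 : ∀ i < N' + 1, memD r (fun j => a ((j + 1) * (N' + 1) + i - 1) / a ((j + 1) * (N' + 1) + i)))
    (hD2 : ∀ i < N' + 1, memD r (fun j => b (j * (N' + 1) + i) / a (j * (N' + 1) + i)))
    (hD3 : ∀ i < N' + 1, memD r (fun j => 1 / a (j * (N' + 1) + i)))
    (hratio : Tendsto (fun n : ℕ => a n / a (n + 1)) atTop (𝓝 1))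
    (hq : Tendsto (fun n : ℕ => b n / a n) atTop (𝓝 q))
    (hdiv : Tendsto a atTop atTop)
    (hq2 : |q| < 2)
    (hqcos : ∀ j : ℕ, 1 ≤ j → j < N' + 1 → q ≠ 2 * Real.cos (j * π / (N' + 1 : ℕ)))
    {K : Set ℝ} (hKc : IsCompact K) :
    ∃ g : ℝ → ℝ, TendstoUniformlyOn (FF a b q) g atTop K ∧ (∀ x ∈ K, 0 < g x) := by
  obtain ⟨g, hg, hgpos, hgb⟩ := base_conv N' r hr a b ha q hD1 hD2 hD3 hratio hq hdiv hq2 hqcos hKc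
  refine ⟨g, ?_, hgpos⟩
  have hK : ∃ C, ∀ x ∈ K, |x| ≤ C := hKc.exists_bound_of_continuousOn (f := fun x => x) continuousOn_id
  set e : ℕ → ℕ := fun j => j * (N' + 1) + N' with he
  have helim' : ∀ l, Tendsto (fun j => e j + l) atTop atTop := fun l => by
    refine tendsto_atTop_mono (fun j => ?_) tendsto_id
    simp only [he, id]; nlinarith [Nat.zero_le N', Nat.zero_le j]
  have hi : ∀ i, Tendsto (fun p : ℕ × ℝ => FF a b q (e p.1 + i) p.2 - g p.2) (uf K) (𝓝 0) := by
    intro i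
    induction i with
    | zero => exact hg
    | succ i ih =>
      have hmap : Tendsto (fun p : ℕ × ℝ => (e p.1 + i, p.2)) (uf K) (uf K) :=
        (helim' i).prodMap tendsto_id
      have hr1 := (FF_ratio ha hq2 hratio hq hdiv hK).comp hmap
      have := unif_mul ih hgb hr1
      refine this.congr fun p => ?_
      have h0 := (FF_pos (b := b) ha hq2 (e p.1 + i) p.2).ne'
      simp only [Function.comp]
      rw [← add_assoc]
      field_simp
  rw [Metric.tendstoUniformlyOn_iff]
  intro η hη
  have hJ : ∀ i, ∃ J, ∀ j ≥ J, ∀ x ∈ K, |FF a b q (e j + i) x - g x| < η := by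
    intro i
    have := Metric.tendsto_nhds.1 (hi i) η hη
    rw [eventually_uf] at this
    simpa using this
  choose J hJ using hJ
  obtain ⟨Jm, hJm⟩ : ∃ Jm, ∀ i < N' + 1, J i ≤ Jm :=
    ⟨(Finset.range (N' + 1)).sup J, fun i hi => Finset.le_sup (Finset.mem_range.2 hi)⟩
  rw [eventually_atTop]
  refine ⟨e Jm, fun n hn x hx => ?_⟩
  rw [dist_comm, Real.dist_eq]
  have hmod := Nat.mod_lt (n - N') (Nat.succ_pos N')
  have hdm := Nat.div_add_mod (n - N') (N' + 1)
  have hn' : e Jm ≤ n := hn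
  have hjj : Jm ≤ (n - N') / (N' + 1) := by
    rw [Nat.le_div_iff_mul_le (Nat.succ_pos N')]
    simp only [he] at hn'
    show Jm * (N' + 1) ≤ n - N'
    omega
  have := hJ ((n - N') % (N' + 1)) ((n - N') / (N' + 1)) ((hJm _ hmod).trans hjj) x hx
  have hidx : e ((n - N') / (N' + 1)) + (n - N') % (N' + 1) = n := by
    simp only [he] at hn' ⊢
    rw [mul_comm]
    omega
  rwa [hidx] at this

theorem thmA
    (N : ℕ) (hN : 0 < N) (r : ℕ) (hr : 1 ≤ r)
    (a b : ℕ → ℝ) (ha : ∀ n, 0 < a n) (q : ℝ)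
    (hD1 : ∀ i < N, memD r (fun j => a ((j + 1) * N + i - 1) / a ((j + 1) * N + i)))
    (hD2 : ∀ i < N, memD r (fun j => b (j * N + i) / a (j * N + i)))
    (hD3 : ∀ i < N, memD r (fun j => 1 / a (j * N + i)))
    (hratio : Tendsto (fun n : ℕ => a n / a (n + 1)) atTop (𝓝 1))
    (hq : Tendsto (fun n : ℕ => b n / a n) atTop (𝓝 q))
    (hdiv : Tendsto a atTop atTop)
    (hq2 : |q| < 2)
    (hqcos : ∀ j : ℕ, 1 ≤ j → j < N → q ≠ 2 * Real.cos (j * π / N)) :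
    ∃ g : ℝ → ℝ, Continuous g ∧ (∀ x, 0 < g x) ∧
      ∀ K : Set ℝ, IsCompact K → TendstoUniformlyOn (FF a b q) g atTop K := by
  obtain ⟨N', rfl⟩ : ∃ N', N = N' + 1 := ⟨N - 1, by omega⟩
  have h := fun K (hKc : IsCompact K) =>
    thmA_K N' r hr a b ha q hD1 hD2 hD3 hratio hq hdiv hq2 hqcos hKc
  have h1 : ∀ x : ℝ, ∃ y, 0 < y ∧ Tendsto (fun n => FF a b q n x) atTop (𝓝 y) := by
    intro x
    obtain ⟨g, hg, hp⟩ := h {x} isCompact_singleton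
    exact ⟨g x, hp x rfl, hg.tendsto_at rfl⟩
  choose g hgpos hglim using h1
  have hK : ∀ K : Set ℝ, IsCompact K → TendstoUniformlyOn (FF a b q) g atTop K := by
    intro K hKc
    obtain ⟨g', hg', _⟩ := h K hKc
    refine hg'.congr_right fun x hx => ?_
    exact tendsto_nhds_unique (hg'.tendsto_at hx) (hglim x)
  refine ⟨g, ?_, hgpos, hK⟩
  have : TendstoLocallyUniformly (FF a b q) g atTop := by
    rw [tendstoLocallyUniformly_iff_forall_isCompact]
    exact hK
  exact this.continuous (Frequently.of_forall fun n => FF_continuous a b q n)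

theorem unif_cesaro {a : ℕ → ℝ} (ha : ∀ n, 0 < a n)
    (hCarleman : Tendsto (fun n : ℕ => ∑ k ∈ Finset.range n, 1 / a k) atTop atTop)
    {K : Set ℝ} (hK : IsCompact K) {c : ℕ → ℝ → ℝ} (hc : ∀ n, Continuous (c n))
    (hl : Tendsto (fun p : ℕ × ℝ => c p.1 p.2) (uf K) (𝓝 0)) :
    Tendsto (fun p : ℕ × ℝ => (∑ j ∈ Finset.range (p.1 + 1), 1 / a j)⁻¹ *
      ∑ j ∈ Finset.range (p.1 + 1), c j p.2 / a j) (uf K) (𝓝 0) := by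
  rcases K.eq_empty_or_nonempty with rfl | hne
  · rw [show uf (∅ : Set ℝ) = ⊥ by simp [uf]]; exact tendsto_bot
  have h1 : ∀ n, ∃ x ∈ K, ∀ y ∈ K, |c n y| ≤ |c n x| := fun n => by
    obtain ⟨x, hx, hm⟩ := hK.exists_isMaxOn hne (f := fun y => |c n y|) (hc n).abs.continuousOn
    exact ⟨x, hx, fun y hy => hm hy⟩
  choose X hXK hX using h1
  have hD : Tendsto (fun n => |c n (X n)|) atTop (𝓝 0) := by
    rw [Metric.tendsto_nhds] at hl ⊢
    intro ε hε
    have := hl ε hε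
    rw [eventually_uf] at this
    obtain ⟨J, hJ⟩ := this
    filter_upwards [eventually_ge_atTop J] with n hn
    simpa using hJ n hn _ (hXK n)
  have ho : (fun n => |c n (X n)| / a n) =o[atTop] fun n => 1 / a n := by
    rw [Asymptotics.isLittleO_iff_tendsto']
    · refine hD.congr fun n => ?_
      have := (ha n).ne'
      field_simp
    · refine Eventually.of_forall fun n h => ?_
      exact absurd h (one_div_pos.2 (ha n)).ne'
  have hs := ho.sum_range (fun n => (one_div_pos.2 (ha n)).le) hCarleman
  have hs2 := (hs.tendsto_div_nhds_zero.comp (tendsto_add_atTop_nat 1)).comp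
    (tendsto_fst : Tendsto _ (uf K) atTop)
  refine squeeze_zero_norm' ?_ hs2
  rw [eventually_uf]
  refine ⟨0, fun n _ x hx => ?_⟩
  have hS : 0 < ∑ j ∈ Finset.range (n + 1), 1 / a j :=
    Finset.sum_pos (fun j _ => one_div_pos.2 (ha j)) ⟨0, by simp⟩
  simp only [Function.comp]
  rw [norm_mul, norm_inv, Real.norm_of_nonneg hS.le, inv_mul_eq_div]
  gcongr
  refine (norm_sum_le _ _).trans (Finset.sum_le_sum fun j _ => ?_)
  rw [Real.norm_eq_abs, abs_div, abs_of_pos (ha j)]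
  exact div_le_div_of_nonneg_right (hX j x hx) (ha j).le

theorem averaging
    {a b : ℕ → ℝ} (ha : ∀ n, 0 < a n) {q : ℝ}
    (hratio : Tendsto (fun n : ℕ => a n / a (n + 1)) atTop (𝓝 1))
    (hq : Tendsto (fun n : ℕ => b n / a n) atTop (𝓝 q))
    (hdiv : Tendsto a atTop atTop)
    (hCarleman : Tendsto (fun n : ℕ => ∑ k ∈ Finset.range n, 1 / a k) atTop atTop)
    (hq2 : |q| < 2) {g : ℝ → ℝ} (hgc : Continuous g)
    {K : Set ℝ} (hKc : IsCompact K) (hg : TendstoUniformlyOn (FF a b q) g atTop K) :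
    TendstoUniformlyOn (fun (n : ℕ) (x : ℝ) =>
          (∑ j ∈ Finset.range (n + 1), 1 / a j)⁻¹ *
            ∑ j ∈ Finset.range (n + 1), (opoly a b j x) ^ 2)
        (fun x => 2 * g x / (4 - q ^ 2)) atTop K := by
  have hK : ∃ C, ∀ x ∈ K, |x| ≤ C := hKc.exists_bound_of_continuousOn (f := fun x => x) continuousOn_id
  obtain ⟨Cg, hCg⟩ : ∃ C, ∀ x ∈ K, |g x| ≤ C := hKc.exists_bound_of_continuousOn hgc.continuousOn
  have hq4 : 0 < 4 - q ^ 2 := by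
    have := sq_lt_sq' (abs_lt.1 hq2).1 (abs_lt.1 hq2).2
    linarith
  set c := 1 - |q| / 2 with hc
  have hc0 : 0 < c := by rw [hc]; linarith
  rw [tuo_iff] at hg ⊢
  set δ : ℕ → ℝ → ℝ := fun j x => ((x - b (j + 1)) / a (j + 1) + q) * opoly a b (j + 1) x +
    (1 - a j / a (j + 1)) * opoly a b j x with hδ
  set η : ℕ → ℝ → ℝ := fun j x => 2 * (FF a b q j x - g x) - a j * (q * opoly a b (j + 1) x * δ j x)
    with hη
  have hcont := opoly_continuous a b
  have hηc : ∀ n, Continuous (η n) := fun n => by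
    have h1 := hcont n
    have h2 := hcont (n + 1)
    have h3 := FF_continuous a b q n
    simp only [hη, hδ]
    fun_prop
  -- bounds
  have hbd : ∃ C, 0 ≤ C ∧ ∀ᶠ p : ℕ × ℝ in uf K, a p.1 * (opoly a b p.1 p.2 ^ 2 + opoly a b (p.1 + 1) p.2 ^ 2) ≤ C := by
    refine ⟨(|Cg| + 1) / c, by positivity, ?_⟩
    have h1 := Metric.tendsto_nhds.1 hg 1 one_pos
    have h2 : ∀ᶠ p : ℕ × ℝ in uf K, |g p.2| ≤ Cg := by
      rw [eventually_uf]; exact ⟨0, fun j _ x hx => hCg x hx⟩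
    filter_upwards [h1, h2] with p h1 h2
    rw [dist_zero_right, Real.norm_eq_abs] at h1
    have h3 := form_lower (q := q) (u := opoly a b p.1 p.2) (v := opoly a b (p.1 + 1) p.2)
    have h4 := mul_le_mul_of_nonneg_left h3 (ha p.1).le
    have h5 : a p.1 * (opoly a b (p.1 + 1) p.2 ^ 2 + q * opoly a b p.1 p.2 * opoly a b (p.1 + 1) p.2 +
      opoly a b p.1 p.2 ^ 2) = FF a b q p.1 p.2 := rfl
    rw [le_div_iff₀ hc0]
    have h6 := le_abs_self Cg
    have h7 := le_abs_self (g p.2)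
    have h8 := (abs_lt.1 h1).2
    rw [h5, ← hc] at h4
    linarith
  obtain ⟨C, hC0, hC⟩ := hbd
  have hηl : Tendsto (fun p : ℕ × ℝ => η p.1 p.2) (uf K) (𝓝 0) := by
    have hβ : Tendsto (fun p : ℕ × ℝ => (p.2 - b (p.1 + 1)) / a (p.1 + 1) + q) (uf K) (𝓝 0) := by
      simpa using (beta_tendsto (e := fun n => n + 1) hq hdiv hK (tendsto_add_atTop_nat 1)).add_const q
    have hα : Tendsto (fun p : ℕ × ℝ => 1 - a p.1 / a (p.1 + 1)) (uf K) (𝓝 0) := by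
      have := (hratio.comp (tendsto_fst : Tendsto _ (uf K) atTop)).const_sub 1
      rw [sub_self] at this
      exact this
    have h1 : Tendsto (fun p : ℕ × ℝ => a p.1 * (q * opoly a b (p.1 + 1) p.2 * δ p.1 p.2)) (uf K) (𝓝 0) := by
      have hb := ((hβ.abs.add hα.abs).mul_const (|q| * C))
      simp only [abs_zero, add_zero, zero_mul] at hb
      refine squeeze_zero_norm' ?_ hb
      filter_upwards [hC] with p hp
      have ha' := ha p.1
      set u := opoly a b p.1 p.2
      set v := opoly a b (p.1 + 1) p.2
      set β := (p.2 - b (p.1 + 1)) / a (p.1 + 1) + q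
      set α := 1 - a p.1 / a (p.1 + 1)
      have e1 : δ p.1 p.2 = β * v + α * u := rfl
      rw [e1, Real.norm_eq_abs, abs_mul, abs_mul, abs_mul, abs_of_pos ha']
      have e2 : |v| * |β * v + α * u| ≤ (|β| + |α|) * (u ^ 2 + v ^ 2) := by
        calc |v| * |β * v + α * u| ≤ |v| * (|β| * |v| + |α| * |u|) := by
              rw [← abs_mul β, ← abs_mul α]; gcongr; exact abs_add_le _ _
          _ ≤ _ := by
              have := abs_nonneg β
              have := abs_nonneg α
              have h1 : |v| * |v| ≤ u ^ 2 + v ^ 2 := by nlinarith [sq_abs v, sq_nonneg u]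
              have h2 : |v| * |u| ≤ u ^ 2 + v ^ 2 := by
                nlinarith [sq_abs v, sq_abs u, sq_nonneg (|u| - |v|), sq_nonneg (|u| + |v|)]
              nlinarith
      calc a p.1 * (|q| * |v| * |β * v + α * u|) = |q| * (a p.1 * (|v| * |β * v + α * u|)) := by ring
        _ ≤ |q| * (a p.1 * ((|β| + |α|) * (u ^ 2 + v ^ 2))) := by gcongr
        _ = (|β| + |α|) * (|q| * (a p.1 * (u ^ 2 + v ^ 2))) := by ring
        _ ≤ _ := by gcongr
    simpa using (hg.const_mul 2).sub h1
  have hces := unif_cesaro ha hCarleman hKc hηc hηl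
  -- boundary
  set B : ℕ → ℝ → ℝ := fun j x => (2 - q ^ 2) * opoly a b j x ^ 2 - q * opoly a b j x * opoly a b (j + 1) x
    with hB
  have hSt : Tendsto (fun p : ℕ × ℝ => (∑ j ∈ Finset.range (p.1 + 1), 1 / a j)⁻¹) (uf K) (𝓝 0) :=
    (tendsto_inv_atTop_zero.comp (hCarleman.comp (tendsto_add_atTop_nat 1))).comp tendsto_fst
  have hB0 : Tendsto (fun p : ℕ × ℝ => B 0 p.2 * (∑ j ∈ Finset.range (p.1 + 1), 1 / a j)⁻¹) (uf K) (𝓝 0) := by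
    refine bdd_mul_zero ?_ hSt
    refine hKc.exists_bound_of_continuousOn (f := B 0) (Continuous.continuousOn ?_)
    have h1 := hcont 0
    have h2 := hcont 1
    simp only [hB]; fun_prop
  have hB1 : Tendsto (fun p : ℕ × ℝ => B (p.1 + 1) p.2 * (∑ j ∈ Finset.range (p.1 + 1), 1 / a j)⁻¹) (uf K) (𝓝 0) := by
    have hb := hSt.const_mul (8 * C)
    rw [mul_zero] at hb
    refine squeeze_zero_norm' ?_ hb
    have ha1 : ∀ᶠ p : ℕ × ℝ in uf K, 1 ≤ a p.1 :=
      (hdiv.comp tendsto_fst).eventually (eventually_ge_atTop 1)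
    filter_upwards [(tendsto_shift K).eventually hC, (tendsto_shift K).eventually ha1] with p hp h1
    have hS : 0 < ∑ j ∈ Finset.range (p.1 + 1), 1 / a j :=
      Finset.sum_pos (fun j _ => one_div_pos.2 (ha j)) ⟨0, by simp⟩
    rw [norm_mul, norm_inv, Real.norm_of_nonneg hS.le]
    gcongr
    simp only [hB]
    set u := opoly a b (p.1 + 1) p.2
    set v := opoly a b (p.1 + 1 + 1) p.2
    have h2 : u ^ 2 + v ^ 2 ≤ C := by nlinarith [sq_nonneg u, sq_nonneg v]
    have hqa := abs_lt.1 hq2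
    have h3 : |q * u * v| ≤ u ^ 2 + v ^ 2 := by
      rw [abs_mul, abs_mul]
      nlinarith [sq_abs v, sq_abs u, sq_nonneg (|u| - |v|), mul_nonneg (abs_nonneg u) (abs_nonneg v)]
    have h4 : |(2 - q ^ 2) * u ^ 2| ≤ 2 * u ^ 2 := by
      rw [abs_mul, abs_of_nonneg (sq_nonneg u)]
      gcongr
      rw [abs_le]; constructor <;> nlinarith
    rw [Real.norm_eq_abs]
    refine (abs_sub _ _).trans ?_
    nlinarith [sq_nonneg u, sq_nonneg v]
  have hfin := ((hces.sub hB1).add hB0).div_const (4 - q ^ 2)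
  simp only [sub_zero, add_zero, zero_div] at hfin
  refine hfin.congr fun p => ?_
  obtain ⟨n, x⟩ := p
  simp only
  have hS : 0 < ∑ j ∈ Finset.range (n + 1), 1 / a j :=
    Finset.sum_pos (fun j _ => one_div_pos.2 (ha j)) ⟨0, by simp⟩
  have key : ∀ j, (4 - q ^ 2) * opoly a b j x ^ 2 + (B (j + 1) x - B j x) = 2 * g x * (1 / a j) + η j x / a j := by
    intro j
    have hw : opoly a b (j + 2) x = -q * opoly a b (j + 1) x - opoly a b j x + δ j x := by
      rw [opoly_rec, hδ]; ring
    have := (ha j).ne'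
    simp only [hB, hη, FF]
    rw [show j + 1 + 1 = j + 2 by ring, hw]
    field_simp
    ring
  have hsum := Finset.sum_congr (rfl : Finset.range (n + 1) = Finset.range (n + 1)) fun j _ => key j
  rw [Finset.sum_add_distrib, Finset.sum_add_distrib, ← Finset.mul_sum, ← Finset.mul_sum,
    Finset.sum_range_sub (fun j => B j x)] at hsum
  set S := ∑ j ∈ Finset.range (n + 1), 1 / a j
  have hS' := hS.ne'
  have hq4' := hq4.ne'
  field_simp
  linear_combination -hsum

/-- solutions of the three term recurrence with inhomogeneity `d` at index zero -/
structure Sol (a b : ℕ → ℝ) (z d : ℂ) (u : ℕ → ℂ) : Prop where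
  zero : (a 0 : ℂ) * u 1 = (z - b 0) * u 0 + d
  succ : ∀ n, (a (n + 1) : ℂ) * u (n + 2) = (z - b (n + 1)) * u (n + 1) - a n * u n

/-- the solution with given initial data -/
def csol (a b : ℕ → ℝ) (d u0 : ℂ) : ℕ → ℂ → ℂ
  | 0 => fun _ => u0
  | 1 => fun z => ((z - b 0) * u0 + d) / a 0
  | (n + 2) => fun z =>
      ((z - b (n + 1)) * csol a b d u0 (n + 1) z - a n * csol a b d u0 n z) / a (n + 1)

theorem csol_sol {a b : ℕ → ℝ} (ha : ∀ n, 0 < a n) (d u0 z : ℂ) :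
    Sol a b z d (fun n => csol a b d u0 n z) := by
  have h : ∀ n, (a n : ℂ) ≠ 0 := fun n => Complex.ofReal_ne_zero.2 (ha n).ne'
  constructor
  · simp only [csol]; rw [mul_div_cancel₀ _ (h 0)]
  · intro n; simp only [csol]; rw [mul_div_cancel₀ _ (h _)]

theorem csol_diff (a b : ℕ → ℝ) (d u0 : ℂ) (n : ℕ) : Differentiable ℂ (csol a b d u0 n) := by
  induction n using Nat.strong_induction_on with
  | _ n ih =>
    match n with
    | 0 => simp [csol]
    | 1 => simp only [csol]; fun_prop
    | (n + 2) =>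
      have h1 := ih (n + 1) (by omega)
      have h0 := ih n (by omega)
      simp only [csol]
      fun_prop

theorem csol_real (a b : ℕ → ℝ) (n : ℕ) (x : ℝ) : csol a b 0 1 n x = (opoly a b n x : ℂ) := by
  induction n using Nat.strong_induction_on with
  | _ n ih =>
    match n with
    | 0 => simp [csol, opoly]
    | 1 => simp [csol, opoly]
    | (n + 2) =>
      have h1 := ih (n + 1) (by omega)
      have h0 := ih n (by omega)
      simp only [csol, opoly, h1, h0]
      push_cast; ring

theorem Sol.add_smul {a b : ℕ → ℝ} {z d e c : ℂ} {u v : ℕ → ℂ} (hu : Sol a b z d u)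
    (hv : Sol a b z e v) : Sol a b z (d + c * e) (fun n => u n + c * v n) := by
  constructor
  · linear_combination hu.zero + c * hv.zero
  · intro n; linear_combination hu.succ n + c * hv.succ n

theorem Sol.eq {a b : ℕ → ℝ} (ha : ∀ n, 0 < a n) {z d : ℂ} {u v : ℕ → ℂ} (hu : Sol a b z d u)
    (hv : Sol a b z d v) (h0 : u 0 = v 0) (n : ℕ) : u n = v n := by
  have h : ∀ n, (a n : ℂ) ≠ 0 := fun n => Complex.ofReal_ne_zero.2 (ha n).ne'
  induction n using Nat.strong_induction_on with
  | _ n ih =>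
    match n with
    | 0 => exact h0
    | 1 =>
      apply mul_left_cancel₀ (h 0)
      rw [hu.zero, hv.zero, h0]
    | (n + 2) =>
      have h1 := ih (n + 1) (by omega)
      have h2 := ih n (by omega)
      apply mul_left_cancel₀ (h (n + 1))
      rw [hu.succ, hv.succ, h1, h2]

theorem Sol.nonzero {a b : ℕ → ℝ} (ha : ∀ n, 0 < a n) {z : ℂ} {u : ℕ → ℂ} (hu : Sol a b z 0 u)
    (h0 : u 0 ≠ 0) (n : ℕ) : ¬ (u n = 0 ∧ u (n + 1) = 0) := by
  have h : ∀ n, (a n : ℂ) ≠ 0 := fun n => Complex.ofReal_ne_zero.2 (ha n).ne'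
  induction n with
  | zero => exact fun h => h0 h.1
  | succ n ih =>
    rintro ⟨h1, h2⟩
    have := hu.succ n
    rw [show n + 2 = n + 1 + 1 by ring, h1, h2] at this
    simp only [mul_zero, zero_sub, zero_eq_neg, mul_eq_zero, h, false_or] at this
    exact ih ⟨this, h1⟩

theorem Sol.green {a b : ℕ → ℝ} {z d : ℂ} {u : ℕ → ℂ} (hu : Sol a b z d u) (n : ℕ) :
    a n * (u (n + 1) * (starRingEnd ℂ) (u n)).im =
      z.im * ∑ k ∈ Finset.range (n + 1), ‖u k‖ ^ 2 + (d * (starRingEnd ℂ) (u 0)).im := by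
  have hn : ∀ w : ℂ, ‖w‖ ^ 2 = w.re ^ 2 + w.im ^ 2 := fun w => by
    rw [← Complex.normSq_eq_norm_sq, Complex.normSq_apply]; ring
  induction n with
  | zero =>
    have h := hu.zero
    have h1 := congrArg Complex.re h
    have h2 := congrArg Complex.im h
    simp only [Complex.mul_re, Complex.mul_im, Complex.ofReal_re, Complex.ofReal_im,
      Complex.sub_re, Complex.sub_im, Complex.add_re, Complex.add_im] at h1 h2
    simp only [zero_add, Finset.range_one, Finset.sum_singleton, hn, Complex.mul_im, Complex.conj_re,
      Complex.conj_im]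
    linear_combination (u 0).re * h2 - (u 0).im * h1
  | succ n ih =>
    have h := hu.succ n
    have h1 := congrArg Complex.re h
    have h2 := congrArg Complex.im h
    simp only [Complex.mul_re, Complex.mul_im, Complex.ofReal_re, Complex.ofReal_im,
      Complex.sub_re, Complex.sub_im] at h1 h2
    rw [Finset.sum_range_succ, mul_add]
    simp only [hn, Complex.mul_im, Complex.conj_re, Complex.conj_im] at ih ⊢
    rw [show n + 1 + 1 = n + 2 by ring]
    linear_combination (u (n + 1)).re * h2 - (u (n + 1)).im * h1 + ih

theorem Sol.wronsk {a b : ℕ → ℝ} {z d e : ℂ} {u v : ℕ → ℂ} (hu : Sol a b z d u)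
    (hv : Sol a b z e v) (n : ℕ) :
    a n * (u (n + 1) * v n - u n * v (n + 1)) = d * v 0 - e * u 0 := by
  induction n with
  | zero => linear_combination v 0 * hu.zero - u 0 * hv.zero
  | succ n ih =>
    rw [show n + 1 + 1 = n + 2 by ring]
    linear_combination v (n + 1) * hu.succ n - u (n + 1) * hv.succ n + ih

/-- the boundary parameter -/
def sg (q : ℝ) : ℂ := ⟨-q / 2, -(Real.sqrt (4 - q ^ 2) / 2)⟩

theorem q4_pos {q : ℝ} (hq2 : |q| < 2) : 0 < 4 - q ^ 2 := by
  have := sq_lt_sq' (abs_lt.1 hq2).1 (abs_lt.1 hq2).2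
  linarith

theorem sg_im {q : ℝ} (hq2 : |q| < 2) : (sg q).im < 0 := by
  have := Real.sqrt_pos.2 (q4_pos hq2)
  simp only [sg]; linarith

/-- denominators -/
def psi (a b : ℕ → ℝ) (q : ℝ) (n : ℕ) (z : ℂ) : ℂ :=
  csol a b 0 1 (n + 1) z - sg q * csol a b 0 1 n z

/-- approximants of the Stieltjes transform -/
def MM (a b : ℕ → ℝ) (q : ℝ) (n : ℕ) (z : ℂ) : ℂ :=
  -(csol a b 1 0 (n + 1) z - sg q * csol a b 1 0 n z) / psi a b q n z

theorem psi_ne {a b : ℕ → ℝ} (ha : ∀ n, 0 < a n) {q : ℝ} (hq2 : |q| < 2) (n : ℕ) {z : ℂ}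
    (hz : 0 ≤ z.im) : psi a b q n z ≠ 0 := by
  intro h
  have hs := csol_sol (b := b) ha 0 1 z
  have h1 : csol a b 0 1 (n + 1) z = sg q * csol a b 0 1 n z := sub_eq_zero.1 h
  have hg := hs.green n
  simp only [h1] at hg
  rw [mul_assoc, Complex.mul_conj, Complex.normSq_eq_norm_sq, Complex.im_mul_ofReal, zero_mul,
    Complex.zero_im, add_zero] at hg
  have hpos : 0 ≤ z.im * ∑ k ∈ Finset.range (n + 1), ‖csol a b 0 1 k z‖ ^ 2 := by positivity
  have h2 : csol a b 0 1 n z = 0 := by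
    by_contra h0
    have h3 : 0 < ‖csol a b 0 1 n z‖ ^ 2 := by positivity
    have := mul_neg_of_neg_of_pos (sg_im hq2) h3
    have := mul_neg_of_pos_of_neg (ha n) this
    linarith
  refine hs.nonzero ha ?_ n ⟨h2, ?_⟩
  · simp [csol]
  · rw [h1, h2, mul_zero]

theorem MM_diff {a b : ℕ → ℝ} (ha : ∀ n, 0 < a n) {q : ℝ} (hq2 : |q| < 2) (n : ℕ) {z : ℂ}
    (hz : 0 ≤ z.im) : DifferentiableAt ℂ (MM a b q n) z := by
  have h1 := csol_diff a b 0 1 n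
  have h2 := csol_diff a b 0 1 (n + 1)
  have h3 := csol_diff a b 1 0 n
  have h4 := csol_diff a b 1 0 (n + 1)
  have h5 := psi_ne (b := b) ha hq2 n hz
  unfold MM
  refine DifferentiableAt.div ?_ ?_ h5
  · fun_prop
  · unfold psi; fun_prop

/-- The Weyl-type solution -/
theorem MM_sol {a b : ℕ → ℝ} (ha : ∀ n, 0 < a n) {q : ℝ} (hq2 : |q| < 2) (n : ℕ) {z : ℂ}
    (hz : 0 ≤ z.im) : ∃ u : ℕ → ℂ, Sol a b z 1 u ∧ u 0 = MM a b q n z ∧ u (n + 1) = sg q * u n ∧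
      (MM a b q n z).im = z.im * ∑ k ∈ Finset.range (n + 1), ‖u k‖ ^ 2 - a n * ((sg q).im * ‖u n‖ ^ 2) := by
  have h := (csol_sol (b := b) ha 1 0 z).add_smul (c := MM a b q n z) (csol_sol (b := b) ha 0 1 z)
  rw [mul_zero, add_zero] at h
  have hu0 : csol a b 1 0 0 z + MM a b q n z * csol a b 0 1 0 z = MM a b q n z := by simp [csol]
  have h1 : csol a b 1 0 (n + 1) z + MM a b q n z * csol a b 0 1 (n + 1) z =
      sg q * (csol a b 1 0 n z + MM a b q n z * csol a b 0 1 n z) := by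
    have h5 := psi_ne (b := b) ha hq2 n hz
    have : MM a b q n z * psi a b q n z = -(csol a b 1 0 (n + 1) z - sg q * csol a b 1 0 n z) := by
      unfold MM; rw [div_mul_cancel₀ _ h5]
    unfold psi at this
    linear_combination this
  refine ⟨_, h, hu0, h1, ?_⟩
  have hg := h.green n
  simp only [h1, hu0] at hg
  rw [mul_assoc (sg q), Complex.mul_conj, Complex.normSq_eq_norm_sq, Complex.im_mul_ofReal, one_mul,
    Complex.conj_im] at hg
  linarith

theorem MM_bound {a b : ℕ → ℝ} (ha : ∀ n, 0 < a n) {q : ℝ} (hq2 : |q| < 2) (n : ℕ) {z : ℂ}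
    (hz : 0 < z.im) : ‖MM a b q n z‖ ≤ 1 / z.im ∧ 0 ≤ (MM a b q n z).im ∧
      ∃ u : ℕ → ℂ, Sol a b z 1 u ∧ u 0 = MM a b q n z ∧
        ∑ k ∈ Finset.range (n + 1), ‖u k‖ ^ 2 ≤ 1 / z.im ^ 2 := by
  obtain ⟨u, hs, h0, h1, him⟩ := MM_sol (b := b) ha hq2 n hz.le
  have h2 : 0 ≤ - (a n * ((sg q).im * ‖u n‖ ^ 2)) := by
    have := sg_im hq2
    have h3 : 0 ≤ ‖u n‖ ^ 2 := by positivity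
    have := mul_nonpos_of_nonpos_of_nonneg this.le h3
    have := mul_nonpos_of_nonneg_of_nonpos (ha n).le this
    linarith
  have h3 : z.im * ∑ k ∈ Finset.range (n + 1), ‖u k‖ ^ 2 ≤ ‖MM a b q n z‖ := by
    have := (le_abs_self _).trans (Complex.abs_im_le_norm (MM a b q n z))
    linarith
  have h4 : ‖MM a b q n z‖ ^ 2 ≤ ∑ k ∈ Finset.range (n + 1), ‖u k‖ ^ 2 := by
    rw [← h0]
    exact Finset.single_le_sum (f := fun k => ‖u k‖ ^ 2) (fun k _ => by positivity) (by simp)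
  have h5 : ‖MM a b q n z‖ ≤ 1 / z.im := by
    rw [le_div_iff₀ hz]
    by_contra hcon
    push Not at hcon
    have hp : 0 < ‖MM a b q n z‖ := by
      by_contra h'
      have : ‖MM a b q n z‖ = 0 := le_antisymm (not_lt.1 h') (norm_nonneg _)
      rw [this] at hcon; linarith
    nlinarith
  refine ⟨h5, ?_, u, hs, h0, ?_⟩
  · rw [him]
    have : 0 ≤ z.im * ∑ k ∈ Finset.range (n + 1), ‖u k‖ ^ 2 := by positivity
    linarith
  · rw [le_div_iff₀ (by positivity)]
    rw [le_div_iff₀ hz] at h5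
    nlinarith

theorem MM_real {a b : ℕ → ℝ} (ha : ∀ n, 0 < a n) {q : ℝ} (hq2 : |q| < 2) (n : ℕ) (x : ℝ) :
    (MM a b q n x).im = (Real.sqrt (4 - q ^ 2) / 2) / FF a b q n x := by
  obtain ⟨u, hs, h0, h1, him⟩ := MM_sol (b := b) (z := x) ha hq2 n (by simp)
  have hw := hs.wronsk (csol_sol (b := b) ha 0 1 x) n
  rw [h1] at hw
  have hw' : -(a n : ℂ) * (u n * psi a b q n x) = 1 := by
    unfold psi
    have : csol a b 0 1 0 (x : ℂ) = 1 := by simp [csol]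
    rw [this] at hw
    linear_combination hw
  have hsq : Real.sqrt (4 - q ^ 2) ^ 2 = 4 - q ^ 2 := Real.sq_sqrt (q4_pos hq2).le
  have hpsi : a n * ‖psi a b q n x‖ ^ 2 = FF a b q n x := by
    unfold psi FF
    rw [csol_real, csol_real, ← Complex.normSq_eq_norm_sq, Complex.normSq_apply]
    congr 1
    simp [sg]
    linear_combination opoly a b n x ^ 2 / 4 * hsq
  have hn : a n ^ 2 * (‖u n‖ ^ 2 * ‖psi a b q n x‖ ^ 2) = 1 := by
    have := congrArg (fun w => ‖w‖ ^ 2) hw'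
    simp only [norm_mul, norm_neg, Complex.norm_real, Real.norm_eq_abs, abs_of_pos (ha n), norm_one] at this
    linear_combination this
  have hF := FF_pos (b := b) ha hq2 n x
  rw [him, Complex.ofReal_im, zero_mul, zero_sub, eq_div_iff hF.ne']
  simp only [sg]
  rw [← hpsi]
  linear_combination Real.sqrt (4 - q ^ 2) / 2 * hn

theorem opoly_sq_int {a b : ℕ → ℝ} {μ : Measure ℝ}
    (horth : ∀ n m : ℕ, ∫ x, opoly a b n x * opoly a b m x ∂μ = if n = m then 1 else 0) (n : ℕ) :
    MemLp (opoly a b n) 2 μ := by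
  rw [memLp_two_iff_integrable_sq (opoly_continuous a b n).aestronglyMeasurable]
  by_contra h
  have h1 := horth n n
  have h2 : (fun x => opoly a b n x * opoly a b n x) = fun x => opoly a b n x ^ 2 := by
    ext x; ring
  rw [h2, integral_undef h] at h1
  simp at h1

/-- Bessel's inequality -/
theorem bessel {a b : ℕ → ℝ} {μ : Measure ℝ}
    (horth : ∀ n m : ℕ, ∫ x, opoly a b n x * opoly a b m x ∂μ = if n = m then 1 else 0)
    {h : ℝ → ℝ} (hh : MemLp h 2 μ) (s : Finset ℕ) :
    ∑ k ∈ s, (∫ x, opoly a b k x * h x ∂μ) ^ 2 ≤ ∫ x, h x ^ 2 ∂μ := by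
  have hp := opoly_sq_int horth
  set c : ℕ → ℝ := fun k => ∫ x, opoly a b k x * h x ∂μ with hc
  have i1 : Integrable (fun x => h x ^ 2) μ := hh.integrable_sq
  have i2 : ∀ k, Integrable (fun x => opoly a b k x * h x) μ := fun k => (hp k).integrable_mul hh
  have i3 : ∀ k l, Integrable (fun x => opoly a b k x * opoly a b l x) μ :=
    fun k l => (hp k).integrable_mul (hp l)
  have key : ∫ x, (h x - ∑ k ∈ s, c k * opoly a b k x) ^ 2 ∂μ = ∫ x, h x ^ 2 ∂μ - ∑ k ∈ s, c k ^ 2 := by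
    have e : ∀ x, (h x - ∑ k ∈ s, c k * opoly a b k x) ^ 2 =
        h x ^ 2 - ∑ k ∈ s, (2 * c k) * (opoly a b k x * h x) +
        ∑ k ∈ s, ∑ l ∈ s, (c k * c l) * (opoly a b k x * opoly a b l x) := by
      intro x
      have e1 : ∑ k ∈ s, (2 * c k) * (opoly a b k x * h x) = 2 * h x * ∑ k ∈ s, c k * opoly a b k x := by
        rw [Finset.mul_sum]; exact Finset.sum_congr rfl fun k _ => by ring
      have e2 : ∑ k ∈ s, ∑ l ∈ s, (c k * c l) * (opoly a b k x * opoly a b l x) =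
          (∑ k ∈ s, c k * opoly a b k x) * (∑ k ∈ s, c k * opoly a b k x) := by
        rw [Finset.sum_mul_sum]
        exact Finset.sum_congr rfl fun k _ => Finset.sum_congr rfl fun l _ => by ring
      rw [e1, e2]; ring
    simp_rw [e]
    have j1 : Integrable (fun x => ∑ k ∈ s, (2 * c k) * (opoly a b k x * h x)) μ :=
      integrable_finsetSum _ fun k _ => (i2 k).const_mul _
    have j2 : Integrable (fun x => ∑ k ∈ s, ∑ l ∈ s, (c k * c l) * (opoly a b k x * opoly a b l x)) μ :=
      integrable_finsetSum _ fun k _ => integrable_finsetSum _ fun l _ => (i3 k l).const_mul _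
    have j0 : Integrable (fun x => h x ^ 2 - ∑ k ∈ s, (2 * c k) * (opoly a b k x * h x)) μ := i1.sub j1
    rw [integral_add j0 j2, integral_sub i1 j1,
      integral_finsetSum _ fun k _ => (i2 k).const_mul _,
      integral_finsetSum _ fun k _ => integrable_finsetSum _ fun l _ => (i3 k l).const_mul _]
    have e3 : ∀ k ∈ s, ∫ x, ∑ l ∈ s, (c k * c l) * (opoly a b k x * opoly a b l x) ∂μ = c k ^ 2 := by
      intro k hk
      rw [integral_finsetSum _ fun l _ => (i3 k l).const_mul _]
      simp_rw [integral_const_mul, horth]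
      simp [hk]; ring
    rw [Finset.sum_congr rfl e3]
    simp_rw [integral_const_mul]
    have e4 : ∑ k ∈ s, 2 * c k * ∫ x, opoly a b k x * h x ∂μ = 2 * ∑ k ∈ s, c k ^ 2 := by
      rw [Finset.mul_sum]; exact Finset.sum_congr rfl fun k _ => by simp only [hc]; ring
    rw [e4]; ring
  have : 0 ≤ ∫ x, (h x - ∑ k ∈ s, c k * opoly a b k x) ^ 2 ∂μ := integral_nonneg fun x => sq_nonneg _
  rw [key] at this
  linarith

theorem sub_ne {z : ℂ} (hz : 0 < z.im) (x : ℝ) : (x : ℂ) - z ≠ 0 := by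
  intro h
  have := congrArg Complex.im h
  simp at this
  linarith

theorem sub_norm {z : ℂ} (hz : 0 < z.im) (x : ℝ) : ‖((x : ℂ) - z)⁻¹‖ ≤ 1 / z.im := by
  rw [norm_inv, one_div]
  gcongr
  have := Complex.abs_im_le_norm ((x : ℂ) - z)
  simp at this
  exact (le_abs_self _).trans this

theorem cauchy_cont {z : ℂ} (hz : 0 < z.im) : Continuous fun x : ℝ => ((x : ℂ) - z)⁻¹ := by
  refine Continuous.inv₀ (by fun_prop) (sub_ne hz)

theorem stieltjes_sol {a b : ℕ → ℝ} (ha : ∀ n, 0 < a n) {μ : Measure ℝ} [IsProbabilityMeasure μ]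
    (horth : ∀ n m : ℕ, ∫ x, opoly a b n x * opoly a b m x ∂μ = if n = m then 1 else 0)
    {z : ℂ} (hz : 0 < z.im) :
    ∃ f : ℕ → ℂ, Sol a b z 1 f ∧ f 0 = ∫ x : ℝ, ((x : ℂ) - z)⁻¹ ∂μ ∧
      ∀ n, ∑ k ∈ Finset.range n, ‖f k‖ ^ 2 ≤ 1 / z.im ^ 2 := by
  have hp := opoly_sq_int horth
  have ip : ∀ k, Integrable (fun x => (opoly a b k x : ℂ)) μ := fun k =>
    ((hp k).integrable one_le_two).ofReal
  have iR : ∀ k, Integrable (fun x => (opoly a b k x : ℂ) * ((x : ℂ) - z)⁻¹) μ := fun k =>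
    (ip k).mul_bdd (c := 1 / z.im) (cauchy_cont hz).aestronglyMeasurable (Eventually.of_forall (sub_norm hz))
  have hintg : ∀ k, ∫ x, (opoly a b k x : ℂ) ∂μ = if k = 0 then 1 else 0 := fun k => by
    have := horth k 0
    simp only [opoly, mul_one] at this
    rw [integral_complex_ofReal, this]
    split_ifs <;> simp
  refine ⟨fun k => ∫ x, (opoly a b k x : ℂ) * ((x : ℂ) - z)⁻¹ ∂μ, ⟨?_, fun n => ?_⟩, ?_, fun n => ?_⟩
  · have h0 := hintg 0
    simp only [if_true] at h0
    rw [← h0, ← integral_const_mul, ← integral_const_mul,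
      ← integral_add ((iR 0).const_mul _) (ip 0)]
    congr 1; ext x
    have := sub_ne hz x
    have h1 : (a 0 : ℂ) ≠ 0 := Complex.ofReal_ne_zero.2 (ha 0).ne'
    simp only [opoly]
    push_cast
    field_simp
    ring
  · have h0 := hintg (n + 1)
    simp only [Nat.add_eq_zero_iff, one_ne_zero, and_false, if_false] at h0
    have j0 : Integrable (fun x => (z - b (n + 1)) * ((opoly a b (n + 1) x : ℂ) * ((x : ℂ) - z)⁻¹) +
        (opoly a b (n + 1) x : ℂ)) μ := ((iR (n + 1)).const_mul _).add (ip (n + 1))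
    rw [← add_zero ((z - b (n + 1)) * _), ← h0, ← integral_const_mul, ← integral_const_mul,
      ← integral_const_mul, ← integral_add ((iR (n + 1)).const_mul _) (ip (n + 1)),
      ← integral_sub j0 ((iR n).const_mul _)]
    congr 1; ext x
    have := sub_ne hz x
    have h1 : (a (n + 1) : ℂ) ≠ 0 := Complex.ofReal_ne_zero.2 (ha _).ne'
    simp only [opoly]
    push_cast
    field_simp
    ring
  · simp [opoly]
  · have hre : ∀ k, (∫ x, (opoly a b k x : ℂ) * ((x : ℂ) - z)⁻¹ ∂μ).re =
        ∫ x, opoly a b k x * (((x : ℂ) - z)⁻¹).re ∂μ := fun k => by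
      have := integral_re (iR k)
      simp only [RCLike.re_eq_complex_re, Complex.re_ofReal_mul] at this
      exact this.symm
    have him : ∀ k, (∫ x, (opoly a b k x : ℂ) * ((x : ℂ) - z)⁻¹ ∂μ).im =
        ∫ x, opoly a b k x * (((x : ℂ) - z)⁻¹).im ∂μ := fun k => by
      have := integral_im (iR k)
      simp only [RCLike.im_eq_complex_im, Complex.im_ofReal_mul] at this
      exact this.symm
    have hn : ∀ w : ℂ, ‖w‖ ^ 2 = w.re ^ 2 + w.im ^ 2 := fun w => by
      rw [← Complex.normSq_eq_norm_sq, Complex.normSq_apply]; ring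
    have m1 : MemLp (fun x : ℝ => (((x : ℂ) - z)⁻¹).re) 2 μ :=
      MemLp.of_bound (Complex.continuous_re.comp (cauchy_cont hz)).aestronglyMeasurable (1 / z.im)
        (Eventually.of_forall fun x => (Complex.abs_re_le_norm _).trans (sub_norm hz x))
    have m2 : MemLp (fun x : ℝ => (((x : ℂ) - z)⁻¹).im) 2 μ :=
      MemLp.of_bound (Complex.continuous_im.comp (cauchy_cont hz)).aestronglyMeasurable (1 / z.im)
        (Eventually.of_forall fun x => (Complex.abs_im_le_norm _).trans (sub_norm hz x))
    simp_rw [hn, hre, him]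
    rw [Finset.sum_add_distrib]
    refine (add_le_add (bessel horth m1 _) (bessel horth m2 _)).trans ?_
    rw [← integral_add m1.integrable_sq m2.integrable_sq]
    calc ∫ x : ℝ, ((((x : ℂ) - z)⁻¹).re ^ 2 + (((x : ℂ) - z)⁻¹).im ^ 2) ∂μ
        ≤ ∫ x : ℝ, (1 / z.im ^ 2) ∂μ := by
          refine integral_mono (m1.integrable_sq.add m2.integrable_sq) (integrable_const _) fun x => ?_
          simp only
          rw [← hn, ← one_div_pow]
          have := sub_norm hz x
          gcongr
      _ = 1 / z.im ^ 2 := by simp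

theorem MM_tendsto {a b : ℕ → ℝ} (ha : ∀ n, 0 < a n) {q : ℝ} (hq2 : |q| < 2)
    (hCarleman : Tendsto (fun n : ℕ => ∑ k ∈ Finset.range n, 1 / a k) atTop atTop)
    {μ : Measure ℝ} [IsProbabilityMeasure μ]
    (horth : ∀ n m : ℕ, ∫ x, opoly a b n x * opoly a b m x ∂μ = if n = m then 1 else 0)
    {z : ℂ} (hz : 0 < z.im) :
    Tendsto (fun n => MM a b q n z) atTop (𝓝 (∫ x : ℝ, ((x : ℂ) - z)⁻¹ ∂μ)) := by
  obtain ⟨f, hf, hf0, hfs⟩ := stieltjes_sol ha horth hz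
  have hP := csol_sol (b := b) ha 0 1 z
  set P : ℕ → ℂ := fun n => csol a b 0 1 n z with hPdef
  have hP0 : P 0 = 1 := by simp [hPdef, csol]
  have hdiv : Tendsto (fun n : ℕ => ∑ k ∈ Finset.range (n + 1), ‖P k‖ ^ 2) atTop atTop := by
    have h1 : ∀ n : ℕ, z.im * ∑ k ∈ Finset.range n, 1 / a k ≤ ∑ k ∈ Finset.range (n + 1), ‖P k‖ ^ 2 := by
      intro n
      have h2 : ∀ k, z.im * (1 / a k) ≤ (‖P k‖ ^ 2 + ‖P (k + 1)‖ ^ 2) / 2 := by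
        intro k
        have hg := hP.green k
        have h3 : (1 : ℝ) ≤ ∑ k ∈ Finset.range (k + 1), ‖P k‖ ^ 2 := by
          have := Finset.single_le_sum (f := fun k => ‖P k‖ ^ 2) (s := Finset.range (k + 1)) (a := 0)
            (fun k _ => by positivity) (by simp)
          simpa [hP0] using this
        have h4 : (P (k + 1) * (starRingEnd ℂ) (P k)).im ≤ ‖P (k + 1)‖ * ‖P k‖ := by
          have := (le_abs_self _).trans (Complex.abs_im_le_norm (P (k + 1) * (starRingEnd ℂ) (P k)))
          rwa [norm_mul, RCLike.norm_conj] at this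
        simp only [zero_mul, Complex.zero_im, add_zero] at hg
        have h5 : z.im ≤ a k * (‖P (k + 1)‖ * ‖P k‖) := by
          have h6 := mul_le_mul_of_nonneg_left h4 (ha k).le
          nlinarith
        rw [mul_one_div, div_le_iff₀ (ha k)]
        refine h5.trans ?_
        rw [mul_comm]
        have := (ha k).le
        gcongr
        nlinarith [sq_nonneg (‖P (k + 1)‖ - ‖P k‖)]
      rw [Finset.mul_sum]
      refine (Finset.sum_le_sum fun k _ => h2 k).trans ?_
      rw [← Finset.sum_div, Finset.sum_add_distrib]
      have e1 := Finset.sum_range_succ (fun k => ‖P k‖ ^ 2) n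
      have e2 := Finset.sum_range_succ' (fun k => ‖P k‖ ^ 2) n
      nlinarith [sq_nonneg ‖P n‖, sq_nonneg ‖P 0‖]
    exact tendsto_atTop_mono h1 (hCarleman.const_mul_atTop hz)
  rw [tendsto_iff_norm_sub_tendsto_zero]
  have hsq : Tendsto (fun n => ‖MM a b q n z - ∫ x : ℝ, ((x : ℂ) - z)⁻¹ ∂μ‖ ^ 2) atTop (𝓝 0) := by
    have hb : Tendsto (fun n : ℕ => (4 / z.im ^ 2) * (∑ k ∈ Finset.range (n + 1), ‖P k‖ ^ 2)⁻¹) atTop (𝓝 0) := by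
      simpa using (tendsto_inv_atTop_zero.comp hdiv).const_mul (4 / z.im ^ 2)
    refine squeeze_zero (fun n => by positivity) (fun n => ?_) hb
    obtain ⟨_, _, u, hu, hu0, hus⟩ := MM_bound (b := b) ha hq2 n hz
    have hS : 0 < ∑ k ∈ Finset.range (n + 1), ‖P k‖ ^ 2 := by
      have := Finset.single_le_sum (f := fun k => ‖P k‖ ^ 2) (s := Finset.range (n + 1)) (a := 0)
            (fun k _ => by positivity) (by simp)
      simp only [hP0, norm_one, one_pow] at this
      linarith
    rw [← div_eq_mul_inv, le_div_iff₀ hS]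
    set D := MM a b q n z - ∫ x : ℝ, ((x : ℂ) - z)⁻¹ ∂μ with hD
    have heq : ∀ k, u k = f k + D * P k := by
      refine fun k => hu.eq ha (v := fun k => f k + D * P k) ?_ ?_ k
      · have := hf.add_smul (c := D) hP
        rwa [mul_zero, add_zero] at this
      · simp only [hP0, hu0, hf0, hD]; ring
    rw [Finset.mul_sum]
    have h1 : ∀ k, ‖D‖ ^ 2 * ‖P k‖ ^ 2 ≤ 2 * ‖u k‖ ^ 2 + 2 * ‖f k‖ ^ 2 := by
      intro k
      have h2 : ‖D‖ * ‖P k‖ ≤ ‖u k‖ + ‖f k‖ := by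
        rw [← norm_mul, show D * P k = u k - f k by rw [heq]; ring]
        exact norm_sub_le _ _
      have h3 : (‖D‖ * ‖P k‖) ^ 2 ≤ (‖u k‖ + ‖f k‖) ^ 2 := by gcongr
      nlinarith [sq_nonneg (‖u k‖ - ‖f k‖)]
    refine (Finset.sum_le_sum fun k _ => h1 k).trans ?_
    rw [Finset.sum_add_distrib, ← Finset.mul_sum, ← Finset.mul_sum]
    have := hfs (n + 1)
    have e : 4 / z.im ^ 2 = 2 * (1 / z.im ^ 2) + 2 * (1 / z.im ^ 2) := by ring
    linarith
  have := (hsq.sqrt)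
  simpa [Real.sqrt_sq] using this

theorem kernel_eq {x y t : ℝ} : ((((t : ℂ) - ⟨x, y⟩)⁻¹).im) = y / ((t - x) ^ 2 + y ^ 2) := by
  rw [Complex.inv_im, Complex.normSq_apply]
  simp
  ring

theorem kernel_scale {y : ℝ} (hy : 0 < y) (s : ℝ) :
    y / (s ^ 2 + y ^ 2) = y⁻¹ * (1 + (y⁻¹ * s) ^ 2)⁻¹ := by
  have : 0 < s ^ 2 + y ^ 2 := by positivity
  have : 0 < 1 + (y⁻¹ * s) ^ 2 := by positivity
  field_simp
  ring

theorem kernel_integrable {x y : ℝ} (hy : 0 < y) :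
    Integrable fun t : ℝ => y / ((t - x) ^ 2 + y ^ 2) := by
  have h1 : Integrable fun s : ℝ => y / (s ^ 2 + y ^ 2) := by
    simp_rw [kernel_scale hy]
    exact (integrable_inv_one_add_sq.comp_mul_left' (inv_pos.2 hy).ne').const_mul _
  exact h1.comp_sub_right x

theorem kernel_integral {x y : ℝ} (hy : 0 < y) :
    ∫ t : ℝ, y / ((t - x) ^ 2 + y ^ 2) = π := by
  rw [integral_sub_right_eq_self (fun s : ℝ => y / (s ^ 2 + y ^ 2)) x]
  simp_rw [kernel_scale hy]
  rw [integral_const_mul, Measure.integral_comp_mul_left (fun s : ℝ => (1 + s ^ 2)⁻¹),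
    integral_univ_inv_one_add_sq]
  simp only [inv_inv, abs_of_pos hy, smul_eq_mul]
  field_simp

theorem poisson {M : ℂ → ℂ} {C : ℝ} (hd : ∀ z : ℂ, 0 ≤ z.im → DifferentiableAt ℂ M z)
    (hC : ∀ z : ℂ, 0 ≤ z.im → ‖M z‖ ≤ C) {x y : ℝ} (hy : 0 < y) :
    ∫ t : ℝ, M t * ((y / ((t - x) ^ 2 + y ^ 2) : ℝ) : ℂ) = π * M ⟨x, y⟩ := by
  set z : ℂ := ⟨x, y⟩ with hz
  have hzim : z.im = y := rfl
  have hC0 : 0 ≤ C := (norm_nonneg _).trans (hC z (by rw [hzim]; exact hy.le))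
  set F : ℂ → ℂ := fun ζ => dslope M z ζ / (ζ - (starRingEnd ℂ) z) with hF
  have hne : ∀ ζ : ℂ, 0 ≤ ζ.im → ζ - (starRingEnd ℂ) z ≠ 0 := by
    intro ζ h0 h
    have := congrArg Complex.im h
    simp only [Complex.sub_im, Complex.conj_im, hzim, Complex.zero_im] at this
    linarith
  have hFd : ∀ ζ : ℂ, 0 ≤ ζ.im → DifferentiableAt ℂ F ζ := by
    intro ζ h0
    refine DifferentiableAt.div ?_ (by fun_prop) (hne ζ h0)
    by_cases hζ : ζ = z
    · have hopen : {ζ : ℂ | 0 < ζ.im} ∈ 𝓝 z :=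
        (isOpen_lt continuous_const Complex.continuous_im).mem_nhds (by show 0 < z.im; rw [hzim]; exact hy)
      have h1 : DifferentiableOn ℂ (dslope M z) {ζ : ℂ | 0 < ζ.im} := by
        rw [Complex.differentiableOn_dslope hopen]
        intro w hw
        exact (hd w (le_of_lt hw)).differentiableWithinAt
      rw [hζ]
      exact h1.differentiableAt hopen
    · exact (differentiableAt_dslope_of_ne hζ).2 (hd ζ h0)
  -- bound
  have hb : ∀ R : ℝ, ‖z‖ < R → ∀ ζ : ℂ, 0 ≤ ζ.im → R ≤ ‖ζ‖ → ‖F ζ‖ ≤ 2 * C / (R - ‖z‖) ^ 2 := by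
    intro R hR ζ h0 h1
    have hζz : ζ ≠ z := by rintro rfl; linarith
    have hR' : 0 < R - ‖z‖ := by linarith
    have e1 : R - ‖z‖ ≤ ‖ζ - z‖ := by have := norm_sub_norm_le ζ z; linarith
    have e2 : R - ‖z‖ ≤ ‖ζ - (starRingEnd ℂ) z‖ := by
      have := norm_sub_norm_le ζ ((starRingEnd ℂ) z)
      rw [RCLike.norm_conj] at this; linarith
    have e3 : ‖M ζ - M z‖ ≤ 2 * C := by
      have := norm_sub_le (M ζ) (M z)
      have := hC ζ h0
      have := hC z (by rw [hzim]; exact hy.le)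
      linarith
    simp only [hF]
    rw [dslope_of_ne _ hζz, slope_def_field, div_div, norm_div, norm_mul, pow_two]
    gcongr
  have hFr : ∀ t : ℝ, F t = (M t - M z) * (((y / ((t - x) ^ 2 + y ^ 2) : ℝ) : ℂ) / y) := by
    intro t
    have hζz : (t : ℂ) ≠ z := by
      intro h
      have := congrArg Complex.im h
      rw [hzim, Complex.ofReal_im] at this; linarith
    have e : ((t : ℂ) - z) * (t - (starRingEnd ℂ) z) = (((t - x) ^ 2 + y ^ 2 : ℝ) : ℂ) := by
      apply Complex.ext
      · rw [Complex.ofReal_re, Complex.mul_re]; simp [hz]; ring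
      · rw [Complex.ofReal_im, Complex.mul_im]; simp [hz]; ring
    simp only [hF]
    rw [dslope_of_ne _ hζz, slope_def_field, div_div, e]
    have h1 : (((t - x) ^ 2 + y ^ 2 : ℝ) : ℂ) ≠ 0 := Complex.ofReal_ne_zero.2 (by positivity)
    have h2 : (y : ℂ) ≠ 0 := Complex.ofReal_ne_zero.2 hy.ne'
    rw [Complex.ofReal_div]
    field_simp
  have hMc : Continuous fun t : ℝ => M t := by
    rw [continuous_iff_continuousAt]
    intro t
    exact (hd t (by simp)).continuousAt.comp Complex.continuous_ofReal.continuousAt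
  have hkc : Integrable fun t : ℝ => ((y / ((t - x) ^ 2 + y ^ 2) : ℝ) : ℂ) := (kernel_integrable hy).ofReal
  have iM : Integrable fun t : ℝ => M t * ((y / ((t - x) ^ 2 + y ^ 2) : ℝ) : ℂ) :=
    hkc.bdd_mul (c := C) hMc.aestronglyMeasurable (Eventually.of_forall fun t => hC t (by simp))
  have iz : Integrable fun t : ℝ => M z * ((y / ((t - x) ^ 2 + y ^ 2) : ℝ) : ℂ) := hkc.const_mul _
  have iF : Integrable fun t : ℝ => F t := by
    have := (iM.sub iz).div_const (y : ℂ)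
    refine this.congr (Eventually.of_forall fun t => ?_)
    simp only [hFr, Pi.sub_apply]; ring
  have hlim0 : Tendsto (fun R : ℝ => ∫ t in (-R)..R, F t) atTop (𝓝 0) := by
    have hbd : Tendsto (fun R : ℝ => 8 * C * (R / (R - ‖z‖) ^ 2)) atTop (𝓝 0) := by
      have h1 : Tendsto (fun R : ℝ => (R - ‖z‖)⁻¹ + ‖z‖ * ((R - ‖z‖)⁻¹) ^ 2) atTop (𝓝 0) := by
        have h0 : Tendsto (fun R : ℝ => (R - ‖z‖)⁻¹) atTop (𝓝 0) :=
          tendsto_inv_atTop_zero.comp (tendsto_atTop_add_const_right _ _ tendsto_id)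
        have := h0.add ((h0.pow 2).const_mul ‖z‖)
        simpa using this
      have h2 := h1.const_mul (8 * C)
      rw [mul_zero] at h2
      refine h2.congr' ?_
      filter_upwards [eventually_gt_atTop ‖z‖] with R hR
      have : R - ‖z‖ ≠ 0 := by linarith
      field_simp
      ring
    refine squeeze_zero_norm' ?_ hbd
    filter_upwards [eventually_gt_atTop ‖z‖] with R hR
    have hR0 : 0 < R := (norm_nonneg z).trans_lt hR
    have hrect := Complex.integral_boundary_rect_eq_zero_of_differentiableOn F (⟨-R, 0⟩ : ℂ) ⟨R, R⟩ (by
      intro ζ hζ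
      refine (hFd ζ ?_).differentiableWithinAt
      have := hζ.2
      simp only [Set.mem_preimage, Set.uIcc_of_le hR0.le, Set.mem_Icc] at this
      exact this.1)
    simp only [Complex.ofReal_zero, zero_mul, add_zero] at hrect
    set B := 2 * C / (R - ‖z‖) ^ 2 with hB
    have b1 : ‖∫ t in (-R)..R, F (t + R * Complex.I)‖ ≤ B * |R - (-R)| := by
      refine intervalIntegral.norm_integral_le_of_norm_le_const fun t _ => hb R hR _ (by simp [hR0.le]) ?_
      have := Complex.abs_im_le_norm ((t : ℂ) + R * Complex.I)
      simpa [abs_of_pos hR0] using this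
    have b2 : ‖∫ t in (0:ℝ)..R, F (R + t * Complex.I)‖ ≤ B * |R - 0| := by
      refine intervalIntegral.norm_integral_le_of_norm_le_const fun t ht => hb R hR _ ?_ ?_
      · rw [Set.uIoc_of_le hR0.le] at ht; simpa using ht.1.le
      · have := Complex.abs_re_le_norm ((R : ℂ) + t * Complex.I)
        simpa [abs_of_pos hR0] using this
    have b3 : ‖∫ t in (0:ℝ)..R, F ((-R : ℝ) + t * Complex.I)‖ ≤ B * |R - 0| := by
      refine intervalIntegral.norm_integral_le_of_norm_le_const fun t ht => hb R hR _ ?_ ?_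
      · rw [Set.uIoc_of_le hR0.le] at ht; simpa using ht.1.le
      · have := Complex.abs_re_le_norm (((-R : ℝ) : ℂ) + t * Complex.I)
        simpa [abs_of_pos hR0] using this
    have e1 : ∫ t in (-R)..R, F t = (∫ t in (-R)..R, F (t + R * Complex.I)) -
        Complex.I • (∫ t in (0:ℝ)..R, F (R + t * Complex.I)) +
        Complex.I • ∫ t in (0:ℝ)..R, F ((-R : ℝ) + t * Complex.I) := by
      linear_combination hrect
    rw [e1]
    have n1 := norm_add_le ((∫ t in (-R)..R, F (t + R * Complex.I)) -
        Complex.I • (∫ t in (0:ℝ)..R, F (R + t * Complex.I)))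
        (Complex.I • ∫ t in (0:ℝ)..R, F ((-R : ℝ) + t * Complex.I))
    have n2 := norm_sub_le (∫ t in (-R)..R, F (t + R * Complex.I))
        (Complex.I • (∫ t in (0:ℝ)..R, F (R + t * Complex.I)))
    rw [norm_smul, Complex.norm_I, one_mul] at n1 n2
    rw [sub_neg_eq_add, abs_of_pos (by linarith)] at b1
    rw [sub_zero, abs_of_pos hR0] at b2 b3
    have : 8 * C * (R / (R - ‖z‖) ^ 2) = B * (R + R) + B * R + B * R := by rw [hB]; ring
    linarith
  have hlim1 := intervalIntegral_tendsto_integral iF tendsto_neg_atTop_atBot tendsto_id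
  have h0 : ∫ t : ℝ, F t = 0 := tendsto_nhds_unique hlim1 hlim0
  have h1 : ∫ t : ℝ, F t = ((∫ t : ℝ, M t * ((y / ((t - x) ^ 2 + y ^ 2) : ℝ) : ℂ)) -
      ∫ t : ℝ, M z * ((y / ((t - x) ^ 2 + y ^ 2) : ℝ) : ℂ)) / y := by
    rw [← integral_sub iM iz, ← integral_div]
    congr 1; ext t; rw [hFr]; ring
  rw [h0, integral_const_mul, integral_complex_ofReal, kernel_integral hy] at h1
  have h2 : (y : ℂ) ≠ 0 := Complex.ofReal_ne_zero.2 hy.ne'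
  rw [eq_comm, div_eq_zero_iff] at h1
  have h3 := h1.resolve_right h2
  linear_combination h3

theorem sg_norm {q : ℝ} (hq2 : |q| < 2) : ‖sg q‖ = 1 := by
  have h := Real.sq_sqrt (q4_pos hq2).le
  have h2 : ‖sg q‖ ^ 2 = 1 := by
    rw [← Complex.normSq_eq_norm_sq, Complex.normSq_apply]
    simp only [sg]; nlinarith
  nlinarith [norm_nonneg (sg q)]

theorem csol_growth {a b : ℕ → ℝ} (ha : ∀ n, 0 < a n) (n : ℕ) {z : ℂ}
    (hz : ∀ k ≤ n, |b k| + 2 * a k + (if k = 0 then 0 else a (k - 1)) ≤ ‖z‖) (k : ℕ) (hk : k ≤ n) :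
    1 ≤ ‖csol a b 0 1 k z‖ ∧ 2 * ‖csol a b 0 1 k z‖ ≤ ‖csol a b 0 1 (k + 1) z‖ := by
  have hs := csol_sol (b := b) ha 0 1 z
  have hzb : ∀ k, ‖z‖ - |b k| ≤ ‖z - b k‖ := fun k => by
    have := norm_sub_norm_le z (b k : ℂ)
    rwa [Complex.norm_real] at this
  induction k with
  | zero =>
    have h0 := hz 0 hk
    simp only [if_true, add_zero] at h0
    have h1 : ‖csol a b 0 1 0 z‖ = 1 := by simp [csol]
    rw [h1]
    refine ⟨le_rfl, ?_⟩
    have h2 : csol a b 0 1 (0 + 1) z = (z - b 0) / a 0 := by simp [csol]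
    rw [h2, norm_div, Complex.norm_real, Real.norm_of_nonneg (ha 0).le, le_div_iff₀ (ha 0)]
    linarith [hzb 0]
  | succ k ih =>
    obtain ⟨i1, i2⟩ := ih (by omega)
    refine ⟨by linarith, ?_⟩
    have h0 := hz (k + 1) hk
    simp only [Nat.add_eq_zero_iff, one_ne_zero, and_false, if_false, Nat.add_sub_cancel] at h0
    have h2 : csol a b 0 1 (k + 1 + 1) z =
      ((z - b (k + 1)) * csol a b 0 1 (k + 1) z - a k * csol a b 0 1 k z) / a (k + 1) := rfl
    rw [h2, norm_div, Complex.norm_real, Real.norm_of_nonneg (ha (k + 1)).le, le_div_iff₀ (ha (k + 1))]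
    have h3 := norm_sub_norm_le ((z - b (k + 1)) * csol a b 0 1 (k + 1) z) (a k * csol a b 0 1 k z)
    rw [norm_mul, norm_mul, Complex.norm_real, Real.norm_of_nonneg (ha k).le] at h3
    have h4 := hzb (k + 1)
    have h5 : (2 * a (k + 1) + a k) * ‖csol a b 0 1 (k + 1) z‖ ≤
        ‖z - b (k + 1)‖ * ‖csol a b 0 1 (k + 1) z‖ := by
      gcongr; linarith
    have h6 : a k * ‖csol a b 0 1 k z‖ ≤ a k * ‖csol a b 0 1 (k + 1) z‖ := by
      have := (ha k).le
      gcongr; linarith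
    linarith

theorem csol_second {a b : ℕ → ℝ} (ha : ∀ n, 0 < a n) (n : ℕ) {z : ℂ}
    (hz : ∀ k ≤ n, |b k| + 2 * a k + (if k = 0 then 0 else a (k - 1)) ≤ ‖z‖) (k : ℕ) (hk : k ≤ n + 1) :
    ‖csol a b 1 0 k z‖ ≤ (∑ j ∈ Finset.range k, 1 / a j) * ‖csol a b 0 1 k z‖ := by
  induction k with
  | zero => simp [csol]
  | succ k ih =>
    have ih := ih (by omega)
    obtain ⟨g1, g2⟩ := csol_growth ha n hz k (by omega)
    have hw := (csol_sol (b := b) ha 1 0 z).wronsk (csol_sol (b := b) ha 0 1 z) k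
    simp only [csol, mul_one, mul_zero, sub_zero] at hw
    have hak : (a k : ℂ) ≠ 0 := Complex.ofReal_ne_zero.2 (ha k).ne'
    have hw2 : csol a b 1 0 (k + 1) z * csol a b 0 1 k z =
      csol a b 1 0 k z * csol a b 0 1 (k + 1) z + 1 / a k := by
      field_simp; linear_combination hw
    have hn := congrArg norm hw2
    rw [norm_mul] at hn
    have h3 := norm_add_le (csol a b 1 0 k z * csol a b 0 1 (k + 1) z) (1 / (a k : ℂ))
    rw [norm_mul, norm_div, norm_one, Complex.norm_real, Real.norm_of_nonneg (ha k).le, ← hn] at h3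
    have hpos : 0 < ‖csol a b 0 1 k z‖ := by linarith
    rw [Finset.sum_range_succ]
    refine le_of_mul_le_mul_right ?_ hpos
    have h4 : 1 / a k ≤ 1 / a k * (‖csol a b 0 1 (k + 1) z‖ * ‖csol a b 0 1 k z‖) := by
      have := ha k
      refine le_mul_of_one_le_right (by positivity) ?_
      nlinarith
    have h5 := mul_le_mul_of_nonneg_right ih (norm_nonneg (csol a b 0 1 (k + 1) z))
    nlinarith

theorem MM_bdd {a b : ℕ → ℝ} (ha : ∀ n, 0 < a n) {q : ℝ} (hq2 : |q| < 2) (n : ℕ) :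
    ∃ C, ∀ z : ℂ, 0 ≤ z.im → ‖MM a b q n z‖ ≤ C := by
  set c : ℕ → ℝ := fun k => |b k| + 2 * a k + (if k = 0 then 0 else a (k - 1)) with hc
  have hc0 : ∀ k, 0 ≤ c k := fun k => by
    have := (ha k).le; have := (ha (k - 1)).le
    simp only [hc]; split_ifs <;> positivity
  set R := ∑ k ∈ Finset.range (n + 1), c k
  have hR : ∀ z : ℂ, R ≤ ‖z‖ → ∀ k ≤ n, c k ≤ ‖z‖ := fun z hz k hk =>
    (Finset.single_le_sum (fun i _ => hc0 i) (Finset.mem_range.2 (by omega))).trans hz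
  have hcomp : IsCompact (Metric.closedBall (0 : ℂ) R ∩ {z : ℂ | 0 ≤ z.im}) :=
    (isCompact_closedBall 0 R).inter_right (isClosed_le continuous_const Complex.continuous_im)
  obtain ⟨C1, hC1⟩ := hcomp.exists_bound_of_continuousOn (f := MM a b q n)
    (fun z hz => (MM_diff ha hq2 n hz.2).continuousAt.continuousWithinAt)
  set S := ∑ j ∈ Finset.range (n + 1), 1 / a j
  refine ⟨max C1 (3 * S), fun z hz => ?_⟩
  by_cases h : ‖z‖ ≤ R
  · exact (hC1 z ⟨by simpa using h, hz⟩).trans (le_max_left _ _)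
  refine le_trans ?_ (le_max_right _ _)
  have hz' := hR z (not_le.1 h).le
  obtain ⟨g1, g2⟩ := csol_growth ha n hz' n le_rfl
  have s1 := csol_second ha n hz' n (by omega)
  have s2 := csol_second ha n hz' (n + 1) le_rfl
  have hS : ∑ j ∈ Finset.range n, 1 / a j ≤ S := by
    simp only [S]; rw [Finset.sum_range_succ]
    have := ha n
    have : 0 < 1 / a n := by positivity
    linarith
  have hS0 : 0 ≤ S := Finset.sum_nonneg fun i _ => by have := ha i; positivity
  unfold MM
  rw [norm_div, norm_neg]
  have hs := sg_norm hq2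
  have hd : ‖csol a b 0 1 (n + 1) z‖ - ‖csol a b 0 1 n z‖ ≤ ‖psi a b q n z‖ := by
    unfold psi
    have := norm_sub_norm_le (csol a b 0 1 (n + 1) z) (sg q * csol a b 0 1 n z)
    rwa [norm_mul, hs, one_mul] at this
  have hu : ‖csol a b 1 0 (n + 1) z - sg q * csol a b 1 0 n z‖ ≤
      ‖csol a b 1 0 (n + 1) z‖ + ‖csol a b 1 0 n z‖ := by
    have := norm_sub_le (csol a b 1 0 (n + 1) z) (sg q * csol a b 1 0 n z)
    rwa [norm_mul, hs, one_mul] at this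
  rw [div_le_iff₀ (by linarith)]
  have s3 := s1.trans (mul_le_mul_of_nonneg_right hS (norm_nonneg _))
  have s4 := mul_le_mul_of_nonneg_left hd hS0
  have s5 := mul_le_mul_of_nonneg_left g2 hS0
  change _ ≤ S * _ at s2
  nlinarith


theorem MM_real_cont {a b : ℕ → ℝ} (ha : ∀ n, 0 < a n) {q : ℝ} (hq2 : |q| < 2) (n : ℕ) :
    Continuous fun t : ℝ => MM a b q n t := by
  rw [continuous_iff_continuousAt]
  intro t
  exact ContinuousAt.comp (g := MM a b q n) (f := fun t : ℝ => (t : ℂ))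
    (MM_diff ha hq2 n (by simp)).continuousAt Complex.continuous_ofReal.continuousAt

theorem MM_real_nonneg {a b : ℕ → ℝ} (ha : ∀ n, 0 < a n) {q : ℝ} (hq2 : |q| < 2) (n : ℕ) (t : ℝ) :
    0 ≤ (MM a b q n t).im := by
  rw [MM_real ha hq2]
  have := FF_pos (b := b) ha hq2 n t
  positivity

theorem poisson_im {a b : ℕ → ℝ} (ha : ∀ n, 0 < a n) {q : ℝ} (hq2 : |q| < 2) (n : ℕ)
    {x y : ℝ} (hy : 0 < y) :
    Integrable (fun t : ℝ => (MM a b q n t).im * (y / ((t - x) ^ 2 + y ^ 2))) ∧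
    ∫ t : ℝ, (MM a b q n t).im * (y / ((t - x) ^ 2 + y ^ 2)) = π * (MM a b q n ⟨x, y⟩).im := by
  obtain ⟨C, hC⟩ := MM_bdd (b := b) ha hq2 n
  have hp := poisson (fun z hz => MM_diff (b := b) ha hq2 n hz) hC (x := x) hy
  have hi : Integrable fun t : ℝ => MM a b q n t * ((y / ((t - x) ^ 2 + y ^ 2) : ℝ) : ℂ) := by
    refine Integrable.bdd_mul (c := C) (kernel_integrable hy).ofReal
      (MM_real_cont ha hq2 n).aestronglyMeasurable (ae_of_all _ fun t => hC _ (by simp))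
  have e : ∀ t : ℝ, (MM a b q n t).im * (y / ((t - x) ^ 2 + y ^ 2)) =
      Complex.imCLM (MM a b q n t * ((y / ((t - x) ^ 2 + y ^ 2) : ℝ) : ℂ)) := fun t => by
    rw [Complex.imCLM_apply, Complex.im_mul_ofReal]
  simp_rw [e]
  refine ⟨Complex.imCLM.integrable_comp hi, ?_⟩
  rw [Complex.imCLM.integral_comp_comm hi, hp, Complex.imCLM_apply, Complex.im_ofReal_mul]

/-- approximating measures -/
def nu (a b : ℕ → ℝ) (q : ℝ) (n : ℕ) : Measure ℝ :=
  volume.withDensity fun t => ENNReal.ofReal ((MM a b q n t).im / π)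

theorem nu_mass {a b : ℕ → ℝ} (ha : ∀ n, 0 < a n) {q : ℝ} (hq2 : |q| < 2) (n : ℕ) :
    nu a b q n Set.univ ≤ 1 := by
  rw [nu, withDensity_apply _ MeasurableSet.univ, setLIntegral_univ]
  have hc : Continuous fun t : ℝ => (MM a b q n t).im :=
    Complex.continuous_im.comp (MM_real_cont ha hq2 n)
  set F : ℕ → ℝ → ENNReal := fun m t =>
    ENNReal.ofReal (((m + 1 : ℝ) / π) * ((MM a b q n t).im * ((m + 1 : ℝ) / ((t - 0) ^ 2 + (m + 1 : ℝ) ^ 2))))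
  have h1 : ∀ t, Tendsto (fun m => F m t) atTop (𝓝 (ENNReal.ofReal ((MM a b q n t).im / π))) := by
    intro t
    refine ENNReal.tendsto_ofReal ?_
    have hu : Tendsto (fun m : ℕ => (1 : ℝ) / ((m : ℝ) + 1)) atTop (𝓝 0) :=
      tendsto_one_div_add_atTop_nhds_zero_nat
    have h2 : Tendsto (fun m : ℕ => (MM a b q n t).im / π * (1 / (t ^ 2 * ((1 : ℝ) / ((m : ℝ) + 1)) ^ 2 + 1)))
        atTop (𝓝 ((MM a b q n t).im / π * (1 / (t ^ 2 * 0 ^ 2 + 1)))) := by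
      refine Tendsto.const_mul _ (Tendsto.div tendsto_const_nhds ?_ (by norm_num))
      exact ((hu.pow 2).const_mul _).add tendsto_const_nhds
    have e0 : (MM a b q n t).im / π * (1 / (t ^ 2 * 0 ^ 2 + 1)) = (MM a b q n t).im / π := by norm_num
    rw [e0] at h2
    refine h2.congr fun m => ?_
    have : 0 < (m : ℝ) + 1 := by positivity
    have := pi_pos
    have h3 : 0 < t ^ 2 + ((m : ℝ) + 1) ^ 2 := by positivity
    have h4 : t ^ 2 * ((1 : ℝ) / ((m : ℝ) + 1)) ^ 2 + 1 = (t ^ 2 + ((m : ℝ) + 1) ^ 2) / ((m : ℝ) + 1) ^ 2 := by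
      field_simp
    rw [h4, sub_zero]
    field_simp
  have h2 : ∀ m, ∫⁻ t, F m t ≤ 1 := by
    intro m
    have hm : 0 < (m : ℝ) + 1 := by positivity
    obtain ⟨p1, p2⟩ := poisson_im (b := b) ha hq2 n (x := 0) hm
    rw [← ofReal_integral_eq_lintegral_ofReal (p1.const_mul _) (ae_of_all _ fun t => by
      have := MM_real_nonneg (b := b) ha hq2 n t
      have := pi_pos
      change 0 ≤ _
      positivity), integral_const_mul, p2]
    rw [← ENNReal.ofReal_one]
    refine ENNReal.ofReal_le_ofReal ?_
    have h3 := (MM_bound (b := b) ha hq2 n (z := ⟨0, m + 1⟩) hm).1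
    have h4 := (le_abs_self _).trans ((Complex.abs_im_le_norm (MM a b q n ⟨0, m + 1⟩)).trans h3)
    rw [le_div_iff₀ hm] at h4
    have := pi_pos
    field_simp
    linarith
  calc ∫⁻ t : ℝ, ENNReal.ofReal ((MM a b q n t).im / π) = ∫⁻ t : ℝ, liminf (fun m => F m t) atTop := by
        refine lintegral_congr fun t => (h1 t).liminf_eq.symm
    _ ≤ liminf (fun m => ∫⁻ t, F m t) atTop := by
        refine lintegral_liminf_le fun m => ?_
        refine ENNReal.measurable_ofReal.comp (Measurable.const_mul (hc.measurable.mul ?_) _)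
        fun_prop
    _ ≤ 1 := by
        refine (liminf_le_liminf (Eventually.of_forall h2)).trans ?_
        simp

theorem nu_integral {a b : ℕ → ℝ} (ha : ∀ n, 0 < a n) {q : ℝ} (hq2 : |q| < 2) (n : ℕ) (f : ℝ → ℝ) :
    ∫ t, f t ∂(nu a b q n) = ∫ t : ℝ, (MM a b q n t).im / π * f t := by
  have hc : Continuous fun t : ℝ => (MM a b q n t).im :=
    Complex.continuous_im.comp (MM_real_cont ha hq2 n)
  have hm : Measurable fun t : ℝ => ENNReal.ofReal ((MM a b q n t).im / π) :=
    ENNReal.measurable_ofReal.comp (hc.measurable.div_const _)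
  rw [nu, integral_withDensity_eq_integral_toReal_smul hm (ae_of_all _ fun t => ENNReal.ofReal_lt_top)]
  refine integral_congr_ae (ae_of_all _ fun t => ?_)
  have := MM_real_nonneg (b := b) ha hq2 n t
  have := pi_pos
  simp only [smul_eq_mul]
  rw [ENNReal.toReal_ofReal (by positivity)]

theorem nu_kernel {a b : ℕ → ℝ} (ha : ∀ n, 0 < a n) {q : ℝ} (hq2 : |q| < 2) (n : ℕ)
    {x y : ℝ} (hy : 0 < y) :
    ∫ t, y / ((t - x) ^ 2 + y ^ 2) ∂(nu a b q n) = (MM a b q n ⟨x, y⟩).im := by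
  rw [nu_integral ha hq2]
  have := (poisson_im (b := b) ha hq2 n (x := x) hy).2
  have hpi := pi_pos
  have e : ∀ t : ℝ, (MM a b q n t).im / π * (y / ((t - x) ^ 2 + y ^ 2)) =
    π⁻¹ * ((MM a b q n t).im * (y / ((t - x) ^ 2 + y ^ 2))) := fun t => by ring
  simp_rw [e]
  rw [integral_const_mul, this]
  field_simp

theorem mu_kernel {μ : Measure ℝ} [IsFiniteMeasure μ] {x y : ℝ} (hy : 0 < y) :
    ∫ t, y / ((t - x) ^ 2 + y ^ 2) ∂μ = (∫ t : ℝ, ((t : ℂ) - ⟨x, y⟩)⁻¹ ∂μ).im := by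
  have hz : 0 < (⟨x, y⟩ : ℂ).im := hy
  have hi : Integrable (fun t : ℝ => ((t : ℂ) - ⟨x, y⟩)⁻¹) μ :=
    Integrable.of_bound (cauchy_cont hz).aestronglyMeasurable _ (ae_of_all _ (sub_norm hz))
  have := Complex.imCLM.integral_comp_comm hi
  simp only [Complex.imCLM_apply] at this
  rw [← this]
  refine integral_congr_ae (ae_of_all _ fun t => ?_)
  simp only [kernel_eq]


theorem approx_id {f : ℝ → ℝ} (hf : Continuous f) (hs : HasCompactSupport f) {ε : ℝ} (hε : 0 < ε) :
    ∃ y > 0, ∀ t : ℝ, |(∫ x, f x * (y / ((t - x) ^ 2 + y ^ 2))) - π * f t| ≤ ε := by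
  have hpi := pi_pos
  obtain ⟨B, hB⟩ := hf.bounded_above_of_compact_support hs
  have hB0 : 0 ≤ B := (norm_nonneg _).trans (hB 0)
  have hu : UniformContinuous f := hs.uniformContinuous_of_continuous hf
  obtain ⟨δ, hδ, hδf⟩ := Metric.uniformContinuous_iff.1 hu (ε / (2 * π)) (by positivity)
  set D := (1 + δ ^ 2) / δ ^ 2 with hD
  have hD0 : 0 < D := by positivity
  set y := ε / (2 * π * (2 * B + 1) * D) with hy
  have hy0 : 0 < y := by positivity
  have hyD : 2 * B * (y * D) * π ≤ ε / 2 := by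
    have : (2 * B + 1) * (y * D) * π = ε / 2 := by
      rw [hy]; field_simp
    have : 0 ≤ y * D * π := by positivity
    nlinarith
  refine ⟨y, hy0, fun t => ?_⟩
  have hsym : ∀ x, (t - x) ^ 2 = (x - t) ^ 2 := fun x => by ring
  simp_rw [hsym]
  have hk := kernel_integrable (x := t) hy0
  have hk1 := kernel_integrable (x := t) one_pos
  have hfk : Integrable fun x => f x * (y / ((x - t) ^ 2 + y ^ 2)) :=
    Integrable.bdd_mul (c := B) hk hf.aestronglyMeasurable (ae_of_all _ hB)
  have e : (∫ x, f x * (y / ((x - t) ^ 2 + y ^ 2))) - π * f t =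
      ∫ x, (f x - f t) * (y / ((x - t) ^ 2 + y ^ 2)) := by
    rw [← kernel_integral (x := t) hy0, mul_comm _ (f t), ← integral_const_mul, ← integral_sub hfk (hk.const_mul _)]
    refine integral_congr_ae (ae_of_all _ fun x => ?_)
    simp only; ring
  rw [e, ← Real.norm_eq_abs]
  have hbd := norm_integral_le_of_norm_le (f := fun x => (f x - f t) * (y / ((x - t) ^ 2 + y ^ 2)))
    ((hk.const_mul (ε / (2 * π))).add (hk1.const_mul (2 * B * (y * D)))) (ae_of_all _ fun x => ?_)
  · refine hbd.trans ?_
    simp only [Pi.add_apply]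
    rw [integral_add (hk.const_mul _) (hk1.const_mul _), integral_const_mul, integral_const_mul,
      kernel_integral hy0, kernel_integral one_pos]
    have : ε / (2 * π) * π = ε / 2 := by field_simp
    linarith
  · simp only [Pi.add_apply]
    have hk0 : 0 < y / ((x - t) ^ 2 + y ^ 2) := by positivity
    have hk10 : 0 < 1 / ((x - t) ^ 2 + 1 ^ 2) := by positivity
    rw [norm_mul, Real.norm_of_nonneg hk0.le]
    by_cases hx : |x - t| < δ
    · have h1 := (hδf (a := x) (b := t) (by rwa [Real.dist_eq])).le
      rw [dist_eq_norm] at h1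
      have := mul_le_mul_of_nonneg_right h1 hk0.le
      have : 0 ≤ 2 * B * (y * D) * (1 / ((x - t) ^ 2 + 1 ^ 2)) := by positivity
      linarith
    · have h1 : ‖f x - f t‖ ≤ 2 * B := by
        have := norm_sub_le (f x) (f t); linarith [hB x, hB t]
      have h2 : y / ((x - t) ^ 2 + y ^ 2) ≤ y * D * (1 / ((x - t) ^ 2 + 1 ^ 2)) := by
        have h3 : δ ^ 2 ≤ (x - t) ^ 2 := by
          rw [← sq_abs (x - t)]; gcongr; exact not_lt.1 hx
        rw [div_le_iff₀ (by positivity), hD]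
        have h4 : (1:ℝ) ≤ (1 + δ ^ 2) / δ ^ 2 * (1 / ((x - t) ^ 2 + 1 ^ 2)) * ((x - t) ^ 2 + y ^ 2) := by
          rw [div_mul_div_comm, div_mul_eq_mul_div, le_div_iff₀ (by positivity)]
          nlinarith [sq_nonneg y, sq_nonneg (δ * y)]
        nlinarith
      have h5 := mul_le_mul h1 h2 hk0.le (by positivity)
      have : 0 ≤ ε / (2 * π) * (y / ((x - t) ^ 2 + y ^ 2)) := by positivity
      linarith

theorem approx_meas {f : ℝ → ℝ} (hf : Continuous f) (hs : HasCompactSupport f) {ε y : ℝ}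
    (hy : 0 < y) (hyf : ∀ t : ℝ, |(∫ x, f x * (y / ((t - x) ^ 2 + y ^ 2))) - π * f t| ≤ ε)
    (ν : Measure ℝ) [IsFiniteMeasure ν] (hν : ν Set.univ ≤ 1) :
    |(∫ x, f x * ∫ t, y / ((t - x) ^ 2 + y ^ 2) ∂ν) - π * ∫ t, f t ∂ν| ≤ ε := by
  obtain ⟨B, hB⟩ := hf.bounded_above_of_compact_support hs
  have hε : 0 ≤ ε := (abs_nonneg _).trans (hyf 0)
  have hfi : Integrable f := hf.integrable_of_hasCompactSupport hs
  have hkc : Continuous fun p : ℝ × ℝ => y / ((p.2 - p.1) ^ 2 + y ^ 2) :=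
    Continuous.div (by fun_prop) (by fun_prop) (fun p => by positivity)
  have hkb : ∀ s : ℝ, ‖y / (s ^ 2 + y ^ 2)‖ ≤ 1 / y := fun s => by
    rw [Real.norm_of_nonneg (by positivity), div_le_div_iff₀ (by positivity) hy]
    nlinarith [sq_nonneg s]
  have hI : Integrable (fun p : ℝ × ℝ => f p.1 * (y / ((p.2 - p.1) ^ 2 + y ^ 2))) (volume.prod ν) := by
    have h1 : Integrable (fun p : ℝ × ℝ => f p.1) (volume.prod ν) := hfi.comp_fst ν
    exact h1.mul_bdd (c := 1 / y) hkc.aestronglyMeasurable (ae_of_all _ fun p => hkb _)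
  have hsw := integral_integral_swap (f := fun x t => f x * (y / ((t - x) ^ 2 + y ^ 2))) hI
  simp_rw [integral_const_mul] at hsw
  rw [hsw, ← integral_const_mul]
  have hfν : Integrable f ν := Integrable.of_bound hf.aestronglyMeasurable B (ae_of_all _ hB)
  rw [← integral_sub hI.integral_prod_right (hfν.const_mul _), ← Real.norm_eq_abs]
  refine (norm_integral_le_of_norm_le_const (C := ε) (ae_of_all _ fun t => by
    simpa [Real.norm_eq_abs] using hyf t)).trans ?_
  have : ν.real Set.univ ≤ 1 := by
    rw [Measure.real]; exact ENNReal.toReal_le_of_le_ofReal zero_le_one (by simpa using hν)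
  nlinarith

/-- the density -/
def dens (q : ℝ) (g : ℝ → ℝ) (x : ℝ) : ℝ := (Real.sqrt (4 - q ^ 2) / 2) / g x / π

theorem nu_tendsto {a b : ℕ → ℝ} (ha : ∀ n, 0 < a n) {q : ℝ} (hq2 : |q| < 2) {g : ℝ → ℝ}
    (hgc : Continuous g) (hg0 : ∀ x, 0 < g x)
    (hg : ∀ K, IsCompact K → TendstoUniformlyOn (FF a b q) g atTop K)
    {f : ℝ → ℝ} (hf : Continuous f) (hs : HasCompactSupport f) :
    Tendsto (fun n => ∫ t, f t ∂(nu a b q n)) atTop (𝓝 (∫ t, dens q g t * f t)) := by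
  simp_rw [nu_integral ha hq2, MM_real ha hq2]
  have hpi := pi_pos
  have hfi : Integrable f := hf.integrable_of_hasCompactSupport hs
  have hsq := Real.sqrt_nonneg (4 - q ^ 2)
  obtain ⟨c, hc, hcg⟩ : ∃ c > 0, ∀ x ∈ tsupport f, c ≤ g x := by
    rcases (tsupport f).eq_empty_or_nonempty with h | h
    · exact ⟨1, one_pos, by simp [h]⟩
    · obtain ⟨x0, -, hx⟩ := hs.isCompact.exists_isMinOn h hgc.continuousOn
      exact ⟨g x0, hg0 _, fun x hx' => hx hx'⟩
  have hev := Metric.tendstoUniformlyOn_iff.1 (hg _ hs.isCompact) (c / 2) (by positivity)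
  refine tendsto_integral_filter_of_dominated_convergence
    (fun t => (Real.sqrt (4 - q ^ 2) / 2) / (c / 2) / π * ‖f t‖) ?_ ?_ (hfi.norm.const_mul _) ?_
  · refine Eventually.of_forall fun n => Continuous.aestronglyMeasurable ?_
    have := FF_continuous a b q n
    refine Continuous.mul (Continuous.div_const (Continuous.div continuous_const this
      fun x => (FF_pos (b := b) ha hq2 n x).ne') _) hf
  · filter_upwards [hev] with n hn
    refine ae_of_all _ fun t => ?_
    by_cases ht : t ∈ tsupport f
    · have h1 := hn t ht
      rw [Real.dist_eq] at h1
      have h2 : c / 2 ≤ FF a b q n t := by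
        have := (abs_lt.1 h1).2; linarith [hcg t ht]
      have h3 := FF_pos (b := b) ha hq2 n t
      rw [norm_mul, Real.norm_of_nonneg (by positivity)]
      gcongr
    · rw [image_eq_zero_of_notMem_tsupport ht]; simp
  · refine ae_of_all _ fun t => ?_
    have h1 : Tendsto (fun n => FF a b q n t) atTop (𝓝 (g t)) :=
      (hg {t} isCompact_singleton).tendsto_at (Set.mem_singleton t)
    exact ((tendsto_const_nhds.div h1 (hg0 t).ne').div_const _).mul_const _

theorem integral_eq {a b : ℕ → ℝ} (ha : ∀ n, 0 < a n) {q : ℝ} (hq2 : |q| < 2) {g : ℝ → ℝ}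
    (hgc : Continuous g) (hg0 : ∀ x, 0 < g x)
    (hg : ∀ K, IsCompact K → TendstoUniformlyOn (FF a b q) g atTop K)
    (hCarleman : Tendsto (fun n : ℕ => ∑ k ∈ Finset.range n, 1 / a k) atTop atTop)
    {μ : Measure ℝ} [IsProbabilityMeasure μ]
    (horth : ∀ n m : ℕ, ∫ x, opoly a b n x * opoly a b m x ∂μ = if n = m then 1 else 0)
    {f : ℝ → ℝ} (hf : Continuous f) (hs : HasCompactSupport f) :
    ∫ t, f t ∂μ = ∫ t, dens q g t * f t := by
  have hpi := pi_pos
  have hfi : Integrable f := hf.integrable_of_hasCompactSupport hs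
  have key : ∀ ε > 0, π * |(∫ t, f t ∂μ) - ∫ t, dens q g t * f t| ≤ 2 * ε := by
    intro ε hε
    obtain ⟨y, hy, hyf⟩ := approx_id hf hs hε
    have h1 := approx_meas hf hs hy hyf μ (by simp)
    have h2 : ∀ n, |(∫ x, f x * (MM a b q n ⟨x, y⟩).im) - π * ∫ t, f t ∂(nu a b q n)| ≤ ε := by
      intro n
      have hm := nu_mass (b := b) ha hq2 n
      have : IsFiniteMeasure (nu a b q n) := ⟨hm.trans_lt ENNReal.one_lt_top⟩
      have := approx_meas hf hs hy hyf (nu a b q n) hm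
      simp_rw [nu_kernel (b := b) ha hq2 n hy] at this
      exact this
    have h3 : Tendsto (fun n => ∫ x, f x * (MM a b q n ⟨x, y⟩).im) atTop
        (𝓝 (∫ x, f x * ∫ t, y / ((t - x) ^ 2 + y ^ 2) ∂μ)) := by
      refine tendsto_integral_of_dominated_convergence (fun x => ‖f x‖ * (1 / y)) ?_
        (hfi.norm.mul_const _) ?_ ?_
      · intro n
        refine Continuous.aestronglyMeasurable (hf.mul (Complex.continuous_im.comp ?_))
        rw [continuous_iff_continuousAt]
        intro x
        refine ContinuousAt.comp (g := MM a b q n) (f := fun x : ℝ => (⟨x, y⟩ : ℂ))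
          (MM_diff ha hq2 n hy.le).continuousAt (Continuous.continuousAt ?_)
        have : (fun x : ℝ => (⟨x, y⟩ : ℂ)) = fun x : ℝ => (x : ℂ) + y * Complex.I := by
          funext x; apply Complex.ext <;> simp
        rw [this]; fun_prop
      · intro n
        refine ae_of_all _ fun x => ?_
        rw [norm_mul]
        have h3 := (MM_bound (b := b) ha hq2 n (z := ⟨x, y⟩) hy).1
        have h4 := (Complex.abs_im_le_norm (MM a b q n ⟨x, y⟩)).trans h3
        rw [Real.norm_eq_abs (Complex.im _)]
        gcongr
      · refine ae_of_all _ fun x => ?_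
        rw [mu_kernel hy]
        exact ((Complex.continuous_im.tendsto _).comp
          (MM_tendsto (z := ⟨x, y⟩) ha hq2 hCarleman horth hy)).const_mul _
    have h4 := nu_tendsto ha hq2 hgc hg0 hg hf hs
    have h5 := le_of_tendsto' ((h3.sub (h4.const_mul π)).abs) h2
    rw [← abs_of_pos hpi, ← abs_mul]
    rw [abs_le] at *
    constructor <;> nlinarith
  by_contra hne
  have h0 : 0 < |(∫ t, f t ∂μ) - ∫ t, dens q g t * f t| := abs_pos.2 (sub_ne_zero.2 hne)
  have := key (π * |(∫ t, f t ∂μ) - ∫ t, dens q g t * f t| / 4) (by positivity)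
  have : 0 < π * |(∫ t, f t ∂μ) - ∫ t, dens q g t * f t| := by positivity
  linarith

theorem meas_eq {w : ℝ → ℝ} (hw : Continuous w) (hw0 : ∀ x, 0 < w x) {μ : Measure ℝ}
    [IsProbabilityMeasure μ]
    (h : ∀ f : ℝ → ℝ, Continuous f → HasCompactSupport f → ∫ t, f t ∂μ = ∫ t, w t * f t) :
    μ = volume.withDensity (fun x => ENNReal.ofReal (w x)) := by
  have : IsLocallyFiniteMeasure (volume.withDensity (fun x => ENNReal.ofReal (w x))) :=
    IsLocallyFiniteMeasure.withDensity_ofReal hw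
  refine Measure.ext_of_integral_eq_on_compactlySupported fun f => ?_
  rw [h f f.continuous f.hasCompactSupport]
  have hm : Measurable fun x => ENNReal.ofReal (w x) := ENNReal.measurable_ofReal.comp hw.measurable
  rw [integral_withDensity_eq_integral_toReal_smul hm (ae_of_all _ fun t => ENNReal.ofReal_lt_top)]
  refine integral_congr_ae (ae_of_all _ fun t => ?_)
  simp only [smul_eq_mul]
  rw [ENNReal.toReal_ofReal (hw0 t).le]

theorem ignjatovic_aux
    (N : ℕ) (hN : 0 < N) (r : ℕ) (hr : 1 ≤ r)
    (a b : ℕ → ℝ) (ha : ∀ n, 0 < a n) (q : ℝ)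
    (hD1 : ∀ i < N, memD r (fun j => a ((j + 1) * N + i - 1) / a ((j + 1) * N + i)))
    (hD2 : ∀ i < N, memD r (fun j => b (j * N + i) / a (j * N + i)))
    (hD3 : ∀ i < N, memD r (fun j => 1 / a (j * N + i)))
    (hratio : Tendsto (fun n : ℕ => a n / a (n + 1)) atTop (𝓝 1))
    (hq : Tendsto (fun n : ℕ => b n / a n) atTop (𝓝 q))
    (hdiv : Tendsto a atTop atTop)
    (hCarleman : Tendsto (fun n : ℕ => ∑ k ∈ Finset.range n, 1 / a k) atTop atTop)
    (hq2 : |q| < 2)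
    (hqcos : ∀ j : ℕ, 1 ≤ j → j < N → q ≠ 2 * Real.cos (j * π / N))
    (μ : Measure ℝ) (hμ : IsProbabilityMeasure μ)
    (horth : ∀ n m : ℕ, ∫ x, opoly a b n x * opoly a b m x ∂μ = if n = m then 1 else 0) :
    ∃ w : ℝ → ℝ, Continuous w ∧ (∀ x, 0 < w x) ∧
      μ = volume.withDensity (fun x => ENNReal.ofReal (w x)) ∧
      TendstoLocallyUniformly
        (fun (n : ℕ) (x : ℝ) =>
          (∑ j ∈ Finset.range (n + 1), 1 / a j)⁻¹ *
            ∑ j ∈ Finset.range (n + 1), (opoly a b j x) ^ 2)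
        (fun x => 1 / (π * Real.sqrt (4 - q ^ 2) * w x)) atTop := by
  obtain ⟨g, hgc, hg0, hg⟩ := thmA N hN r hr a b ha q hD1 hD2 hD3 hratio hq hdiv hq2 hqcos
  have hpi := pi_pos
  have h4 := q4_pos hq2
  have hsq := Real.sqrt_pos.2 h4
  have hwc : Continuous (dens q g) := by
    unfold dens
    exact (continuous_const.div hgc fun x => (hg0 x).ne').div_const _
  have hw0 : ∀ x, 0 < dens q g x := fun x => by
    have := hg0 x
    unfold dens; positivity
  refine ⟨dens q g, hwc, hw0, ?_, ?_⟩
  · exact meas_eq hwc hw0 fun f hf hs => integral_eq ha hq2 hgc hg0 hg hCarleman horth hf hs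
  · rw [tendstoLocallyUniformly_iff_forall_isCompact]
    intro K hK
    have e : (fun x => 1 / (π * Real.sqrt (4 - q ^ 2) * dens q g x)) =
        fun x => 2 * g x / (4 - q ^ 2) := by
      funext x
      have h5 := Real.mul_self_sqrt h4.le
      have := hg0 x
      unfold dens
      generalize Real.sqrt (4 - q ^ 2) = s at *
      rw [← h5]
      field_simp
    rw [e]
    exact averaging ha hratio hq hdiv hCarleman hq2 hgc hK (hg K hK)

/-- Corollary 1 of the paper; resolution of the Ignjatović conjecture.
Convergence of the normalized Christoffel function for Jacobi parameters with
`a_{n-1}/a_n → 1`, `b_n/a_n → q`, `a_n → ∞`, satisfying the Carleman condition and Stolz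
regularity, provided `|q| < 2` and `q ∉ {2cos(jπ/N)}`. -/
theorem ignjatovic_conjecture
    (N : ℕ) (hN : 0 < N) (r : ℕ) (hr : 1 ≤ r)
    (a b : ℕ → ℝ) (ha : ∀ n, 0 < a n) (q : ℝ)
    (hD1 : ∀ i < N, memD r (fun j => a ((j + 1) * N + i - 1) / a ((j + 1) * N + i)))
    (hD2 : ∀ i < N, memD r (fun j => b (j * N + i) / a (j * N + i)))
    (hD3 : ∀ i < N, memD r (fun j => 1 / a (j * N + i)))
    (hratio : Tendsto (fun n : ℕ => a n / a (n + 1)) atTop (𝓝 1))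
    (hq : Tendsto (fun n : ℕ => b n / a n) atTop (𝓝 q))
    (hdiv : Tendsto a atTop atTop)
    (hCarleman : Tendsto (fun n : ℕ => ∑ k ∈ Finset.range n, 1 / a k) atTop atTop)
    (hq2 : |q| < 2)
    (hqcos : ∀ j : ℕ, 1 ≤ j → j < N → q ≠ 2 * Real.cos (j * π / N))
    (μ : Measure ℝ) (hμ : IsProbabilityMeasure μ)
    (horth : ∀ n m : ℕ, ∫ x, opoly a b n x * opoly a b m x ∂μ = if n = m then 1 else 0) :
    ∃ w : ℝ → ℝ, Continuous w ∧ (∀ x, 0 < w x) ∧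
      μ = volume.withDensity (fun x => ENNReal.ofReal (w x)) ∧
      TendstoLocallyUniformly
        (fun (n : ℕ) (x : ℝ) =>
          (∑ j ∈ Finset.range (n + 1), 1 / a j)⁻¹ *
            ∑ j ∈ Finset.range (n + 1), (opoly a b j x) ^ 2)
        (fun x => 1 / (π * Real.sqrt (4 - q ^ 2) * w x)) atTop := by
  exact ignjatovic_aux N hN r hr a b ha q hD1 hD2 hD3 hratio hq hdiv hCarleman hq2 hqcos μ hμ horth
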